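/- Every sequence (Γⁿ) of BV graph-type connections in a triangle T admits a subsequence converging, in the sense that φ_{ij}(Γⁿ_{ij}) → φ_{ij}(Γ_{ij}) in L¹([0,ℓ_{ij}]) for each ij ∈ {12,23,31}, to a limit Γ which is itself a BV graph-type connection in T (in particular the three limit curves share a common triple point p ∈ T that splits them compatibly). -/

import Mathlib

open Set MeasureTheory Filter

noncomputable section

/-- The generalized graph of `φ : [0,l] → ℝ` (extended by `0` outside `[0,l]`): all points
`(s, θ φ(s₋) + (1−θ) φ(s₊))` with `s ∈ [0,l]`, `θ ∈ [0,1]`. -/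
def genGraph (φ : ℝ → ℝ) (l : ℝ) : Set (ℝ × ℝ) :=
  {q : ℝ × ℝ | ∃ s ∈ Icc (0:ℝ) l, ∃ θ ∈ Icc (0:ℝ) 1, ∃ lm rm : ℝ,
    Tendsto φ (nhdsWithin s (Iio s)) (nhds lm) ∧
    Tendsto φ (nhdsWithin s (Ioi s)) (nhds rm) ∧
    q = (s, θ * lm + (1 - θ) * rm)}

/-- The (plain) graph of `φ` over `[0,l]`. -/
def plainGraph (φ : ℝ → ℝ) (l : ℝ) : Set (ℝ × ℝ) :=
  {q : ℝ × ℝ | ∃ s ∈ Icc (0:ℝ) l, q = (s, φ s)}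

/-- Planar coordinates over the side from `a` to `b` of a triangle in `ℂ ≅ ℝ²`: `(s,t)`
is sent to the point at arclength `s` along the side, displaced by `t` in the direction
normal to the side. -/
def sideEmbed (a b : ℂ) (q : ℝ × ℝ) : ℂ :=
  a + (q.1 / ‖b - a‖) • (b - a) + (q.2 / ‖b - a‖) • (Complex.I * (b - a))

/-- A BV graph-type connection in the triangle `T ⊆ ℂ` with vertices `α₁, α₂, α₃`: three
curves `Γᵢ ⊆ T` with `αᵢ ∈ Γᵢ`, mutually intersecting exactly at the target triple point
`p`, such that each `Γᵢ ∪ Γⱼ` is the generalized graph of a BV function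
`φᵢⱼ : [0, ℓᵢⱼ] → ℝ` over the side `αᵢαⱼ` (with `ℓᵢⱼ = |αⱼ − αᵢ|`, and `φᵢⱼ` extended by
`0` outside `[0, ℓᵢⱼ]`). -/
structure BVConn (α₁ α₂ α₃ : ℂ) where
  Γ₁ : Set ℂ
  Γ₂ : Set ℂ
  Γ₃ : Set ℂ
  p : ℂ
  φ₁₂ : ℝ → ℝ
  φ₂₃ : ℝ → ℝ
  φ₃₁ : ℝ → ℝ
  p_mem : p ∈ convexHull ℝ ({α₁, α₂, α₃} : Set ℂ)
  sub₁ : Γ₁ ⊆ convexHull ℝ ({α₁, α₂, α₃} : Set ℂ)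
  sub₂ : Γ₂ ⊆ convexHull ℝ ({α₁, α₂, α₃} : Set ℂ)
  sub₃ : Γ₃ ⊆ convexHull ℝ ({α₁, α₂, α₃} : Set ℂ)
  int₁₂ : Γ₁ ∩ Γ₂ = {p}
  int₂₃ : Γ₂ ∩ Γ₃ = {p}
  int₃₁ : Γ₃ ∩ Γ₁ = {p}
  mem₁ : α₁ ∈ Γ₁
  mem₂ : α₂ ∈ Γ₂
  mem₃ : α₃ ∈ Γ₃
  ext₁₂ : ∀ s : ℝ, s ∉ Icc (0:ℝ) ‖α₂ - α₁‖ → φ₁₂ s = 0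
  ext₂₃ : ∀ s : ℝ, s ∉ Icc (0:ℝ) ‖α₃ - α₂‖ → φ₂₃ s = 0
  ext₃₁ : ∀ s : ℝ, s ∉ Icc (0:ℝ) ‖α₁ - α₃‖ → φ₃₁ s = 0
  bv₁₂ : BoundedVariationOn φ₁₂ (Icc 0 ‖α₂ - α₁‖)
  bv₂₃ : BoundedVariationOn φ₂₃ (Icc 0 ‖α₃ - α₂‖)
  bv₃₁ : BoundedVariationOn φ₃₁ (Icc 0 ‖α₁ - α₃‖)
  graph₁₂ : Γ₁ ∪ Γ₂ = sideEmbed α₁ α₂ '' genGraph φ₁₂ ‖α₂ - α₁‖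
  graph₂₃ : Γ₂ ∪ Γ₃ = sideEmbed α₂ α₃ '' genGraph φ₂₃ ‖α₃ - α₂‖
  graph₃₁ : Γ₃ ∪ Γ₁ = sideEmbed α₃ α₁ '' genGraph φ₃₁ ‖α₁ - α₃‖

/-- A connection is Lipschitz graph-type when the three functions are Lipschitz and each
`Γᵢ ∪ Γⱼ` is the plain graph of `φᵢⱼ` (no vertical parts). -/
def BVConn.IsLip {α₁ α₂ α₃ : ℂ} (Γ : BVConn α₁ α₂ α₃) : Prop :=
  (∃ K : NNReal, LipschitzOnWith K Γ.φ₁₂ (Icc 0 ‖α₂ - α₁‖)) ∧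
  (∃ K : NNReal, LipschitzOnWith K Γ.φ₂₃ (Icc 0 ‖α₃ - α₂‖)) ∧
  (∃ K : NNReal, LipschitzOnWith K Γ.φ₃₁ (Icc 0 ‖α₁ - α₃‖)) ∧
  Γ.Γ₁ ∪ Γ.Γ₂ = sideEmbed α₁ α₂ '' plainGraph Γ.φ₁₂ ‖α₂ - α₁‖ ∧
  Γ.Γ₂ ∪ Γ.Γ₃ = sideEmbed α₂ α₃ '' plainGraph Γ.φ₂₃ ‖α₃ - α₂‖ ∧
  Γ.Γ₃ ∪ Γ.Γ₁ = sideEmbed α₃ α₁ '' plainGraph Γ.φ₃₁ ‖α₁ - α₃‖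

end

open Topology

theorem exists_monotone_jump_iff {J : Set ℝ} (hJ : J.Countable) :
    ∃ f : ℝ → ℝ, Monotone f ∧
      ∀ s, s ∈ J ↔ Function.leftLim f s < Function.rightLim f s := by
  rcases J.eq_empty_or_nonempty with rfl | hne
  · refine ⟨id, monotone_id, fun s => ?_⟩
    have h1 : Function.leftLim (id : ℝ → ℝ) s = s :=
      (continuous_id.continuousWithinAt).leftLim_eq
    have h2 : Function.rightLim (id : ℝ → ℝ) s = s :=
      (continuous_id.continuousWithinAt).rightLim_eq
    simp [h1, h2]
  obtain ⟨j, rfl⟩ := hJ.exists_eq_range hne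
  have hp0 : (⟨1 / 2, by norm_num, by norm_num⟩ : unitInterval) ≠ 0 := by
    intro h; have := congrArg Subtype.val h; norm_num at this
  have hp1 : (⟨1 / 2, by norm_num, by norm_num⟩ : unitInterval) ≠ 1 := by
    intro h; have := congrArg Subtype.val h; norm_num at this
  set g := ProbabilityTheory.geometricMeasure ⟨1 / 2, by norm_num, by norm_num⟩ with hg
  have hj : Measurable j := measurable_of_countable j
  have : IsProbabilityMeasure (g.map j) := Measure.isProbabilityMeasure_map hj.aemeasurable
  refine ⟨ProbabilityTheory.cdf (g.map j), ProbabilityTheory.monotone_cdf _, fun s => ?_⟩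
  have h1 : (ProbabilityTheory.cdf (g.map j)).measure {s} = g (j ⁻¹' {s}) := by
    rw [ProbabilityTheory.measure_cdf, Measure.map_apply hj (measurableSet_singleton s)]
  rw [StieltjesFunction.measure_singleton] at h1
  rw [StieltjesFunction.rightLim_eq, ← sub_pos, ← ENNReal.ofReal_pos, h1]
  constructor
  · rintro ⟨n, rfl⟩
    refine lt_of_lt_of_le ?_ (measure_mono (s := {n}) (by simp))
    rw [ProbabilityTheory.geometricMeasure_singleton hp0, ENNReal.ofReal_pos]
    exact ProbabilityTheory.geometricMeasure_pos hp0 hp1 n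
  · intro h
    obtain ⟨n, hn⟩ := nonempty_of_measure_ne_zero h.ne'
    exact ⟨n, hn⟩

theorem exists_tendsto_left_of_boundedVariationOn_Icc {φ : ℝ → ℝ} {l : ℝ}
    (hext : ∀ s, s ∉ Icc (0 : ℝ) l → φ s = 0)
    (hbv : BoundedVariationOn φ (Icc 0 l)) {s : ℝ} (hs : s ∈ Icc 0 l) :
    ∃ lm, Tendsto φ (𝓝[<] s) (𝓝 lm) ∧ (s = 0 → lm = 0) := by
  rcases hs.1.eq_or_lt with rfl | h0
  · refine ⟨0, ?_, fun _ => rfl⟩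
    refine tendsto_const_nhds.congr' ?_
    filter_upwards [self_mem_nhdsWithin] with x hx
    exact (hext x fun h => absurd h.1 (not_le.2 hx)).symm
  · obtain ⟨m, hm⟩ := hbv.exists_tendsto_left s
    refine ⟨m, ?_, fun h => absurd h h0.ne'⟩
    rwa [nhdsWithin_inter_of_mem (Icc_mem_nhdsLT_of_mem ⟨h0, hs.2⟩)] at hm

theorem exists_tendsto_right_of_boundedVariationOn_Icc {φ : ℝ → ℝ} {l : ℝ}
    (hext : ∀ s, s ∉ Icc (0 : ℝ) l → φ s = 0)
    (hbv : BoundedVariationOn φ (Icc 0 l)) {s : ℝ} (hs : s ∈ Icc 0 l) :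
    ∃ rm, Tendsto φ (𝓝[>] s) (𝓝 rm) ∧ (s = l → rm = 0) := by
  rcases hs.2.eq_or_lt with rfl | h0
  · refine ⟨0, ?_, fun _ => rfl⟩
    refine tendsto_const_nhds.congr' ?_
    filter_upwards [self_mem_nhdsWithin] with x hx
    exact (hext x fun h => absurd h.2 (not_le.2 hx)).symm
  · obtain ⟨m, hm⟩ := hbv.exists_tendsto_right s
    refine ⟨m, ?_, fun h => absurd h h0.ne⟩
    rwa [nhdsWithin_inter_of_mem (Icc_mem_nhdsGT_of_mem ⟨hs.1, h0⟩)] at hm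

theorem countable_jumps_of_boundedVariationOn_Icc {φ : ℝ → ℝ} {l : ℝ}
    (hbv : BoundedVariationOn φ (Icc 0 l)) {lm rm : ℝ → ℝ}
    (hl : ∀ s ∈ Icc (0 : ℝ) l, Tendsto φ (𝓝[<] s) (𝓝 (lm s)))
    (hr : ∀ s ∈ Icc (0 : ℝ) l, Tendsto φ (𝓝[>] s) (𝓝 (rm s))) :
    {s ∈ Icc (0 : ℝ) l | lm s ≠ rm s}.Countable := by
  obtain ⟨p, q, hp, hq, hpq⟩ := hbv.locallyBoundedVariationOn.exists_monotoneOn_sub_monotoneOn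
  refine ((hp.countable_not_continuousWithinAt.union hq.countable_not_continuousWithinAt).union
    (countable_singleton (0 : ℝ) |>.union (countable_singleton l))).mono ?_
  rintro s ⟨hs, hne⟩
  by_contra hcon
  simp only [mem_union, mem_ofPred_eq, not_or, not_and, not_not, mem_singleton_iff] at hcon
  obtain ⟨⟨hcp, hcq⟩, hs0, hsl⟩ := hcon
  have hnhds : Icc 0 l ∈ 𝓝 s :=
    Icc_mem_nhds (lt_of_le_of_ne hs.1 (Ne.symm hs0)) (lt_of_le_of_ne hs.2 hsl)
  have hc : ContinuousAt φ s := by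
    rw [hpq]
    exact ((hcp hs).continuousAt hnhds).sub ((hcq hs).continuousAt hnhds)
  exact hne ((tendsto_nhds_unique (hl s hs) (hc.tendsto.mono_left nhdsWithin_le_nhds)).trans
    (tendsto_nhds_unique (hr s hs) (hc.tendsto.mono_left nhdsWithin_le_nhds)).symm)

/-- For `s ↦ s + f s` with `f` monotone, every level between the limits at `0` and `l` lies in some jump. -/
theorem exists_mem_jump {f : ℝ → ℝ} (hf : Monotone f) {l r : ℝ} (hl : 0 ≤ l)
    (hr : r ∈ Icc (0 + Function.leftLim f 0) (l + Function.rightLim f l)) :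
    ∃ s ∈ Icc 0 l, r ∈ Icc (s + Function.leftLim f s) (s + Function.rightLim f s) := by
  set S := {s ∈ Icc 0 l | s + Function.leftLim f s ≤ r} with hS
  have h0 : (0 : ℝ) ∈ S := ⟨⟨le_rfl, hl⟩, hr.1⟩
  have hbdd : BddAbove S := ⟨l, fun x hx => hx.1.2⟩
  have hm0 : 0 ≤ sSup S := le_csSup hbdd h0
  have hml : sSup S ≤ l := csSup_le ⟨0, h0⟩ fun x hx => hx.1.2
  refine ⟨sSup S, ⟨hm0, hml⟩, ?_, ?_⟩
  · by_contra hcon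
    rw [not_le] at hcon
    have ht : Tendsto (fun s => s + f s) (𝓝[<] (sSup S))
        (𝓝 (sSup S + Function.leftLim f (sSup S))) :=
      (tendsto_id.mono_left nhdsWithin_le_nhds).add (hf.tendsto_leftLim _)
    obtain ⟨x, hxr, hxS⟩ := ((ht.eventually (lt_mem_nhds hcon)).and self_mem_nhdsWithin).exists
    obtain ⟨y, hy, hxy⟩ := exists_lt_of_lt_csSup ⟨0, h0⟩ hxS
    have := hf.le_leftLim hxy
    linarith [hy.2]
  · rcases hml.eq_or_lt with h | h
    · rw [h]; exact hr.2
    have ht : Tendsto (fun s => s + f s) (𝓝[>] (sSup S))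
        (𝓝 (sSup S + Function.rightLim f (sSup S))) :=
      (tendsto_id.mono_left nhdsWithin_le_nhds).add (hf.tendsto_rightLim _)
    refine ge_of_tendsto ht ?_
    filter_upwards [Ioo_mem_nhdsGT h] with x hx
    by_contra hcon
    rw [not_le] at hcon
    have : x ∈ S := ⟨⟨hm0.trans hx.1.le, hx.2.le⟩, by linarith [hf.leftLim_le (le_refl x)]⟩
    exact absurd (le_csSup hbdd this) (not_le.2 hx.1)

/-- The generalized graph of a function of bounded variation is a simple arc on which the first
coordinate is monotone. -/
theorem exists_param_genGraph {φ : ℝ → ℝ} {l : ℝ} (hl0 : 0 ≤ l)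
    (hext : ∀ s, s ∉ Icc (0 : ℝ) l → φ s = 0)
    (hbv : BoundedVariationOn φ (Icc 0 l)) :
    ∃ A B : ℝ, ∃ c : ℝ → ℝ × ℝ, A ≤ B ∧ ContinuousOn c (Icc A B) ∧ InjOn c (Icc A B) ∧
      c '' Icc A B = genGraph φ l ∧ c A = (0, 0) ∧ c B = (l, 0) ∧
      MonotoneOn (fun r => (c r).1) (Icc A B) := by
  have hL := fun s (hs : s ∈ Icc 0 l) =>
    exists_tendsto_left_of_boundedVariationOn_Icc hext hbv hs
  have hR := fun s (hs : s ∈ Icc 0 l) =>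
    exists_tendsto_right_of_boundedVariationOn_Icc hext hbv hs
  choose! lm hlm hlm0 using hL
  choose! rm hrm hrml using hR
  obtain ⟨f, hf, hJ⟩ := exists_monotone_jump_iff
    (countable_jumps_of_boundedVariationOn_Icc hbv hlm hrm)
  set F : ℝ → ℝ := fun s => s + Function.leftLim f s with hFdef
  set G : ℝ → ℝ := fun s => s + Function.rightLim f s with hGdef
  have hFG : ∀ s, F s ≤ G s := fun s => by
    have := hf.leftLim_le_rightLim (le_refl s); simp only [hFdef, hGdef]; linarith
  have hslope : ∀ s s', s < s' → G s + (s' - s) ≤ F s' := fun s s' h => by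
    have := hf.rightLim_le_leftLim h; simp only [hFdef, hGdef]; linarith
  have hJ' : ∀ s ∈ Icc 0 l, (F s < G s ↔ lm s ≠ rm s) := fun s hs => by
    have := hJ s
    simp only [hFdef, hGdef, add_lt_add_iff_left, ← this]
    exact ⟨fun h => h.2, fun h => ⟨hs, h⟩⟩
  have hσ : ∀ r ∈ Icc (F 0) (G l), ∃ s ∈ Icc 0 l, r ∈ Icc (F s) (G s) := fun r hr =>
    exists_mem_jump hf hl0 hr
  choose! σ hσ0 hσr using hσ
  have huniq : ∀ s s' r, r ∈ Icc (F s) (G s) → r ∈ Icc (F s') (G s') → s = s' := by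
    intro s s' r h h'
    rcases lt_trichotomy s s' with hlt | heq | hgt
    · linarith [hslope _ _ hlt, h.2, h'.1]
    · exact heq
    · linarith [hslope _ _ hgt, h'.2, h.1]
  have hσlip : ∀ r ∈ Icc (F 0) (G l), ∀ r' ∈ Icc (F 0) (G l), |σ r - σ r'| ≤ |r - r'| := by
    intro r hr r' hr'
    rcases lt_trichotomy (σ r) (σ r') with hlt | heq | hgt
    · have := hslope _ _ hlt
      rw [abs_of_nonpos (by linarith), abs_of_nonpos (by linarith [(hσr r hr).2, (hσr r' hr').1])]
      linarith [(hσr r hr).2, (hσr r' hr').1]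
    · rw [heq, sub_self, abs_zero]; exact abs_nonneg _
    · have := hslope _ _ hgt
      rw [abs_of_nonneg (by linarith), abs_of_nonneg (by linarith [(hσr r hr).1, (hσr r' hr').2])]
      linarith [(hσr r hr).1, (hσr r' hr').2]
  have hσmono : MonotoneOn σ (Icc (F 0) (G l)) := by
    intro r hr r' hr' hrr'
    by_contra hcon
    have := hslope _ _ (not_le.1 hcon)
    linarith [(hσr r hr).1, (hσr r' hr').2, not_le.1 hcon]
  set h : ℝ → ℝ → ℝ := fun s r => lm s + (rm s - lm s) * ((r - F s) / (G s - F s)) with hh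
  have hhF : ∀ s, h s (F s) = lm s := fun s => by simp [hh]
  have hhG : ∀ s ∈ Icc 0 l, h s (G s) = rm s := fun s hs => by
    rcases (hFG s).eq_or_lt with he | hlt
    · have : lm s = rm s := by
        by_contra hne; exact absurd ((hJ' s hs).2 hne) (by simp [he])
      simp [hh, this]
    · simp [hh, div_self (sub_pos.2 hlt).ne']
  have hFG0 : F 0 ≤ G l := by
    rcases hl0.eq_or_lt with rfl | hlt
    · exact hFG 0
    · linarith [hFG 0, hFG l, hslope _ _ hlt]
  have hin : ∀ s ∈ Icc 0 l, ∀ r ∈ Icc (F s) (G s), r ∈ Icc (F 0) (G l) := by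
    intro s hs r hr
    constructor
    · rcases hs.1.eq_or_lt with rfl | hlt
      · exact hr.1
      · linarith [hFG 0, hslope _ _ hlt, hr.1]
    · rcases hs.2.eq_or_lt with rfl | hlt
      · exact hr.2
      · linarith [hFG l, hslope _ _ hlt, hr.2]
  have hσeq : ∀ s ∈ Icc 0 l, ∀ r ∈ Icc (F s) (G s), σ r = s := fun s hs r hr =>
    huniq _ _ r (hσr r (hin s hs r hr)) hr
  have hhseg : ∀ r ∈ Icc (F 0) (G l), ∀ m δ, |lm (σ r) - m| ≤ δ → |rm (σ r) - m| ≤ δ →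
      |h (σ r) r - m| ≤ δ := by
    intro r hr m δ h1 h2
    have hr' := hσr r hr
    set θ := (r - F (σ r)) / (G (σ r) - F (σ r)) with hθ
    have hθ0 : 0 ≤ θ := div_nonneg (by linarith [hr'.1]) (by linarith [hFG (σ r)])
    have hθ1 : θ ≤ 1 := div_le_one_of_le₀ (by linarith [hr'.2]) (by linarith [hFG (σ r)])
    have : h (σ r) r - m = (1 - θ) * (lm (σ r) - m) + θ * (rm (σ r) - m) := by
      simp only [hh, ← hθ]; ring
    rw [this, abs_le]
    rw [abs_le] at h1 h2
    constructor <;> nlinarith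
  refine ⟨F 0, G l, fun r => (σ r, h (σ r) r), hFG0, ?_, ?_, ?_, ?_, ?_, hσmono⟩
  · have hσc : ContinuousOn σ (Icc (F 0) (G l)) := by
      rw [Metric.continuousOn_iff]
      intro r hr ε hε
      refine ⟨ε, hε, fun r' hr' hd => ?_⟩
      rw [Real.dist_eq] at hd ⊢
      exact (hσlip r' hr' r hr).trans_lt hd
    refine hσc.prodMk ?_
    intro r hr
    set s := σ r with hs
    have hs0 : s ∈ Icc 0 l := hσ0 r hr
    rw [ContinuousWithinAt, Metric.tendsto_nhds]
    intro ε hε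
    have hε3 : 0 < ε / 3 := by positivity
    have hcont : ContinuousAt (h s) r := by
      simp only [hh]; fun_prop
    have hε1 : ∀ᶠ r' in 𝓝[Icc (F 0) (G l)] r, |h s r' - h s r| < ε / 3 :=
      (Metric.tendsto_nhds.1 (hcont.tendsto.mono_left nhdsWithin_le_nhds) _ hε3)
    have hnearL : ∀ᶠ x in 𝓝[<] s, ∀ y ∈ Icc 0 l, y = x →
        |lm y - lm s| ≤ ε / 3 ∧ |rm y - lm s| ≤ ε / 3 := by
      have h1 := Metric.tendsto_nhds.1 (hlm s hs0) _ hε3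
      obtain ⟨a, ha, hsub⟩ := (mem_nhdsLT_iff_exists_Ioo_subset).1 h1
      filter_upwards [Ioo_mem_nhdsLT ha] with x hx y hy hyx
      subst hyx
      constructor
      · refine le_of_tendsto ((hlm y hy).sub_const (lm s)).abs ?_
        filter_upwards [Ioo_mem_nhdsLT hx.1] with z hz
        exact (hsub ⟨hz.1, hz.2.trans hx.2⟩ : dist _ _ < _).le
      · refine le_of_tendsto ((hrm y hy).sub_const (lm s)).abs ?_
        filter_upwards [Ioo_mem_nhdsGT hx.2] with z hz
        exact (hsub ⟨hx.1.trans hz.1, hz.2⟩ : dist _ _ < _).le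
    have hnearR : ∀ᶠ x in 𝓝[>] s, ∀ y ∈ Icc 0 l, y = x →
        |lm y - rm s| ≤ ε / 3 ∧ |rm y - rm s| ≤ ε / 3 := by
      have h1 := Metric.tendsto_nhds.1 (hrm s hs0) _ hε3
      obtain ⟨a, ha, hsub⟩ := (mem_nhdsGT_iff_exists_Ioo_subset).1 h1
      filter_upwards [Ioo_mem_nhdsGT ha] with x hx y hy hyx
      subst hyx
      constructor
      · refine le_of_tendsto ((hlm y hy).sub_const (rm s)).abs ?_
        filter_upwards [Ioo_mem_nhdsLT hx.1] with z hz
        exact (hsub ⟨hz.1, hz.2.trans hx.2⟩ : dist _ _ < _).le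
      · refine le_of_tendsto ((hrm y hy).sub_const (rm s)).abs ?_
        filter_upwards [Ioo_mem_nhdsGT hx.2] with z hz
        exact (hsub ⟨hx.1.trans hz.1, hz.2⟩ : dist _ _ < _).le
    have hσt : Tendsto σ (𝓝[Icc (F 0) (G l)] r) (𝓝 s) := hσc r hr
    have hεL := hσt.eventually (eventually_nhdsWithin_iff.1 hnearL)
    have hεR := hσt.eventually (eventually_nhdsWithin_iff.1 hnearR)
    filter_upwards [hε1, hεL, hεR, self_mem_nhdsWithin] with r' h1 h2 h3 hr'
    have hsr := hσr r hr
    have hsr' := hσr r' hr'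
    rw [Real.dist_eq]
    have hmono_between : ∀ u v w : ℝ, u ∈ Icc v w ∨ u ∈ Icc w v →
        |h s u - h s v| ≤ |h s w - h s v| := by
      intro u v w huvw
      have e1 : h s u - h s v = (rm s - lm s) / (G s - F s) * (u - v) := by
        simp only [hh]; ring
      have e2 : h s w - h s v = (rm s - lm s) / (G s - F s) * (w - v) := by
        simp only [hh]; ring
      rw [e1, e2, abs_mul, abs_mul]
      refine mul_le_mul_of_nonneg_left ?_ (abs_nonneg _)
      rcases huvw with hu | hu
      · rw [abs_of_nonneg (by linarith [hu.1]), abs_of_nonneg (by linarith [hu.1, hu.2])]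
        linarith [hu.2]
      · rw [abs_of_nonpos (by linarith [hu.2]), abs_of_nonpos (by linarith [hu.1, hu.2])]
        linarith [hu.1]
    rcases lt_trichotomy (σ r') s with hlt | heq | hgt
    · obtain ⟨ha, hb⟩ := h2 hlt _ (hσ0 r' hr') rfl
      have h4 := hhseg r' hr' _ _ ha hb
      have hle : r' ≤ F s := by linarith [hslope _ _ hlt, hsr'.2]
      have h5 := hmono_between (F s) r r' (Or.inr ⟨hle, hsr.1⟩)
      rw [hhF] at h5
      have : h (σ r') r' - h s r = (h (σ r') r' - lm s) + (lm s - h s r) := by ring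
      rw [this]
      refine (abs_add_le _ _).trans_lt ?_
      linarith
    · rw [heq]; linarith
    · obtain ⟨ha, hb⟩ := h3 hgt _ (hσ0 r' hr') rfl
      have h4 := hhseg r' hr' _ _ ha hb
      have hle : G s ≤ r' := by linarith [hslope _ _ hgt, hsr'.1]
      have h5 := hmono_between (G s) r r' (Or.inl ⟨hsr.2, hle⟩)
      rw [hhG s hs0] at h5
      have : h (σ r') r' - h s r = (h (σ r') r' - rm s) + (rm s - h s r) := by ring
      rw [this]
      refine (abs_add_le _ _).trans_lt ?_
      linarith
  · intro r hr r' hr' heq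
    obtain ⟨h1, h2⟩ := Prod.mk.inj heq
    rw [h1] at h2
    by_contra hne
    have ha := hσr r hr
    have hb := hσr r' hr'
    rw [h1] at ha
    have hlt : F (σ r') < G (σ r') := by
      rcases lt_or_gt_of_ne hne with h | h
      · linarith [ha.1, hb.2]
      · linarith [ha.2, hb.1]
    have hne' := (hJ' _ (hσ0 r' hr')).1 hlt
    have h3 : (rm (σ r') - lm (σ r')) / (G (σ r') - F (σ r')) * (r - r') = 0 := by
      simp only [hh] at h2
      linear_combination h2
    rcases mul_eq_zero.1 h3 with h4 | h4
    · rcases div_eq_zero_iff.1 h4 with h5 | h5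
      · exact hne' (by linarith)
      · linarith
    · exact hne (by linarith)
  · ext q
    constructor
    · rintro ⟨r, hr, rfl⟩
      have hr' := hσr r hr
      refine ⟨σ r, hσ0 r hr, 1 - (r - F (σ r)) / (G (σ r) - F (σ r)), ?_, lm (σ r), rm (σ r),
        hlm _ (hσ0 r hr), hrm _ (hσ0 r hr), ?_⟩
      · constructor
        · rw [sub_nonneg]
          exact div_le_one_of_le₀ (by linarith [hr'.2]) (by linarith [hFG (σ r)])
        · rw [sub_le_self_iff]
          exact div_nonneg (by linarith [hr'.1]) (by linarith [hFG (σ r)])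
      · refine Prod.ext rfl ?_
        simp only [hh]; ring
    · rintro ⟨s, hs, θ, hθ, lm', rm', h1, h2, rfl⟩
      rw [tendsto_nhds_unique h1 (hlm s hs), tendsto_nhds_unique h2 (hrm s hs)]
      have hrmem : F s + (1 - θ) * (G s - F s) ∈ Icc (F s) (G s) := by
        constructor <;> nlinarith [hFG s, hθ.1, hθ.2]
      refine ⟨F s + (1 - θ) * (G s - F s), hin s hs _ hrmem, ?_⟩
      have he := hσeq s hs _ hrmem
      refine Prod.ext he ?_
      simp only [he, hh, add_sub_cancel_left]
      rcases (hFG s).eq_or_lt with h | h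
      · have : lm s = rm s := by
          by_contra hne; exact absurd ((hJ' s hs).2 hne) (by simp [h])
        rw [this]; ring
      · rw [mul_div_assoc, div_self (sub_pos.2 h).ne']; ring
  · have he := hσeq 0 ⟨le_rfl, hl0⟩ (F 0) ⟨le_rfl, hFG 0⟩
    refine Prod.ext he ?_
    simp only [he, hhF]
    exact hlm0 0 ⟨le_rfl, hl0⟩ rfl
  · have he := hσeq l ⟨hl0, le_rfl⟩ (G l) ⟨hFG l, le_rfl⟩
    refine Prod.ext he ?_
    simp only [he, hhG l ⟨hl0, le_rfl⟩]
    exact hrml l ⟨hl0, le_rfl⟩ rfl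

/-- The Euclidean inner product of `ℂ = ℝ²`, in coordinates. -/
def planeDot (v x : ℂ) : ℝ := v.re * x.re + v.im * x.im

theorem continuous_planeDot (v : ℂ) : Continuous (planeDot v) := by
  unfold planeDot; fun_prop

theorem planeDot_neg (v x : ℂ) : planeDot (-v) x = -planeDot v x := by
  simp [planeDot]; ring

/-- `G` is a simple arc from `a` to `b` along which the component in direction `d` is
nondecreasing. -/
def IsMonoArc (d : ℂ) (G : Set ℂ) (a b : ℂ) : Prop :=
  ∃ (A B : ℝ) (c : ℝ → ℂ), A ≤ B ∧ ContinuousOn c (Icc A B) ∧ InjOn c (Icc A B) ∧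
    c '' Icc A B = G ∧ c A = a ∧ c B = b ∧ MonotoneOn (fun r => planeDot d (c r)) (Icc A B)

theorem IsMonoArc.isCompact {d : ℂ} {G : Set ℂ} {a b : ℂ} (h : IsMonoArc d G a b) :
    IsCompact G := by
  obtain ⟨A, B, c, -, hc, -, rfl, -⟩ := h
  exact isCompact_Icc.image_of_continuousOn hc

theorem IsMonoArc.reverse {d : ℂ} {G : Set ℂ} {a b : ℂ} (h : IsMonoArc d G a b) :
    IsMonoArc (-d) G b a := by
  obtain ⟨A, B, c, hAB, hc, hi, rfl, ha, hb, hm⟩ := h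
  have hmap : ∀ r ∈ Icc (-B) (-A), -r ∈ Icc A B := fun r hr =>
    ⟨by linarith [hr.2], by linarith [hr.1]⟩
  refine ⟨-B, -A, fun r => c (-r), by linarith, hc.comp continuousOn_neg hmap, ?_, ?_,
    by simpa using hb, by simpa using ha, ?_⟩
  · intro r hr s hs hrs
    exact neg_injective (hi (hmap r hr) (hmap s hs) hrs)
  · ext x
    constructor
    · rintro ⟨r, hr, rfl⟩
      exact ⟨-r, hmap r hr, rfl⟩
    · rintro ⟨r, hr, rfl⟩
      exact ⟨-r, ⟨by linarith [hr.2], by linarith [hr.1]⟩, by simp⟩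
  · intro r hr s hs hrs
    have := hm (hmap s hs) (hmap r hr) (neg_le_neg hrs)
    simp only [planeDot_neg] at this ⊢
    linarith

/-- An arc that is the union of two closed sets meeting in one point is cut by this point. -/
theorem IsMonoArc.split {d : ℂ} {S R : Set ℂ} {a b p : ℂ} (h : IsMonoArc d (S ∪ R) a b)
    (hS : IsClosed S) (hR : IsClosed R) (hSR : S ∩ R = {p}) (ha : a ∈ S) (hb : b ∈ R) :
    IsMonoArc d S a p ∧ IsMonoArc d R p b := by
  obtain ⟨A, B, c, hAB, hc, hi, him, hca, hcb, hm⟩ := h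
  have hp : p ∈ S ∩ R := hSR ▸ rfl
  obtain ⟨m, hmI, hmp⟩ : p ∈ c '' Icc A B := him ▸ Or.inl hp.1
  have hsub : ∀ r ∈ Icc A B, c r ∈ S ∪ R := fun r hr => him ▸ mem_image_of_mem c hr
  have heq : ∀ r ∈ Icc A B, c r ∈ S → c r ∈ R → r = m := fun r hr h1 h2 => by
    have : c r ∈ S ∩ R := ⟨h1, h2⟩
    rw [hSR] at this
    exact hi hr hmI (by rw [hmp]; exact this)
  have key : ∀ J : Set ℝ, J.OrdConnected → J ⊆ Icc A B → m ∉ J →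
      c '' J ⊆ S ∨ c '' J ⊆ R := fun J hJ hJI hmJ => by
    refine isPreconnected_iff_subset_of_disjoint_closed.1
      ((isPreconnected_iff_ordConnected.2 hJ).image c (hc.mono hJI)) S R hS hR ?_ ?_
    · rintro _ ⟨r, hr, rfl⟩
      exact hsub r (hJI hr)
    · ext x
      simp only [mem_inter_iff, mem_image, mem_empty_iff_false, iff_false, not_and]
      rintro ⟨r, hr, rfl⟩ h1 h2
      exact hmJ (heq r (hJI hr) h1 h2 ▸ hr)
  have hleft : ∀ r ∈ Icc A m, c r ∈ S := by
    intro r hr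
    rcases hr.2.eq_or_lt with h | h
    · rw [h, hmp]; exact hp.1
    rcases key (Ico A m) ordConnected_Ico (fun x hx => ⟨hx.1, hx.2.le.trans hmI.2⟩)
      (fun h => lt_irrefl _ h.2) with h' | h'
    · exact h' ⟨r, ⟨hr.1, h⟩, rfl⟩
    · have hA : A < m := hr.1.trans_lt h
      have := heq A ⟨le_rfl, hAB⟩ (hca ▸ ha) (h' ⟨A, ⟨le_rfl, hA⟩, rfl⟩)
      exact absurd this hA.ne
  have hright : ∀ r ∈ Icc m B, c r ∈ R := by
    intro r hr
    rcases hr.1.eq_or_lt with h | h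
    · rw [← h, hmp]; exact hp.2
    rcases key (Ioc m B) ordConnected_Ioc (fun x hx => ⟨hmI.1.trans hx.1.le, hx.2⟩)
      (fun h => lt_irrefl _ h.1) with h' | h'
    · have hB : m < B := h.trans_le hr.2
      have := heq B ⟨hAB, le_rfl⟩ (h' ⟨B, ⟨hB, le_rfl⟩, rfl⟩) (hcb ▸ hb)
      exact absurd this hB.ne'
    · exact h' ⟨r, ⟨h, hr.2⟩, rfl⟩
  have hl : Icc A m ⊆ Icc A B := Icc_subset_Icc_right hmI.2
  have hr : Icc m B ⊆ Icc A B := Icc_subset_Icc_left hmI.1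
  refine ⟨⟨A, m, c, hmI.1, hc.mono hl, hi.mono hl, ?_, hca, hmp, hm.mono hl⟩,
    ⟨m, B, c, hmI.2, hc.mono hr, hi.mono hr, ?_, hmp, hcb, hm.mono hr⟩⟩
  · refine Subset.antisymm (image_subset_iff.2 hleft) fun x hx => ?_
    obtain ⟨r, hr, rfl⟩ : x ∈ c '' Icc A B := him ▸ Or.inl hx
    rcases le_total r m with h | h
    · exact ⟨r, ⟨hr.1, h⟩, rfl⟩
    · exact ⟨m, ⟨hmI.1, le_rfl⟩, by rw [heq r hr hx (hright r ⟨h, hr.2⟩)]⟩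
  · refine Subset.antisymm (image_subset_iff.2 hright) fun x hx => ?_
    obtain ⟨r, hr, rfl⟩ : x ∈ c '' Icc A B := him ▸ Or.inr hx
    rcases le_total m r with h | h
    · exact ⟨r, ⟨h, hr.2⟩, rfl⟩
    · exact ⟨m, ⟨le_rfl, hmI.2⟩, by rw [heq r hr (hleft r ⟨hr.1, h⟩) hx]⟩

theorem sideEmbed_continuous (a b : ℂ) : Continuous (sideEmbed a b) := by
  unfold sideEmbed; fun_prop

theorem sideEmbed_zero (a b : ℂ) : sideEmbed a b (0, 0) = a := by
  simp [sideEmbed]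

theorem sideEmbed_length {a b : ℂ} (h : a ≠ b) : sideEmbed a b (‖b - a‖, 0) = b := by
  have : ‖b - a‖ ≠ 0 := norm_ne_zero_iff.2 (sub_ne_zero.2 h.symm)
  simp [sideEmbed, div_self this]

theorem planeDot_self (v : ℂ) : planeDot v v = ‖v‖ ^ 2 := by
  rw [Complex.sq_norm, Complex.normSq_apply, planeDot]

theorem planeDot_sideEmbed {a b : ℂ} (h : a ≠ b) (q : ℝ × ℝ) :
    planeDot (b - a) (sideEmbed a b q) = planeDot (b - a) a + q.1 * ‖b - a‖ := by
  have h0 : ‖b - a‖ ≠ 0 := norm_ne_zero_iff.2 (sub_ne_zero.2 h.symm)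
  have h1 := planeDot_self (b - a)
  have h2 : planeDot (b - a) (sideEmbed a b q) =
      planeDot (b - a) a + q.1 / ‖b - a‖ * planeDot (b - a) (b - a) := by
    simp [planeDot, sideEmbed]; ring
  rw [h2, h1]; field_simp

theorem planeDot_mul_I_sideEmbed {a b : ℂ} (h : a ≠ b) (q : ℝ × ℝ) :
    planeDot (Complex.I * (b - a)) (sideEmbed a b q) =
      planeDot (Complex.I * (b - a)) a + q.2 * ‖b - a‖ := by
  have h0 : ‖b - a‖ ≠ 0 := norm_ne_zero_iff.2 (sub_ne_zero.2 h.symm)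
  have h1 := planeDot_self (b - a)
  have h2 : planeDot (Complex.I * (b - a)) (sideEmbed a b q) =
      planeDot (Complex.I * (b - a)) a + q.2 / ‖b - a‖ * planeDot (b - a) (b - a) := by
    simp [planeDot, sideEmbed]; ring
  rw [h2, h1]; field_simp

/-- Inverse of `sideEmbed`. -/
noncomputable def sideCoord (a b x : ℂ) : ℝ × ℝ :=
  (planeDot (b - a) (x - a) / ‖b - a‖, planeDot (Complex.I * (b - a)) (x - a) / ‖b - a‖)

theorem planeDot_sub (v x y : ℂ) : planeDot v (x - y) = planeDot v x - planeDot v y := by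
  simp [planeDot]; ring

theorem sideCoord_sideEmbed {a b : ℂ} (h : a ≠ b) (q : ℝ × ℝ) :
    sideCoord a b (sideEmbed a b q) = q := by
  have h0 : ‖b - a‖ ≠ 0 := norm_ne_zero_iff.2 (sub_ne_zero.2 h.symm)
  simp [sideCoord, planeDot_sub _ _ a, planeDot_sideEmbed h, planeDot_mul_I_sideEmbed h, h0]

theorem sideEmbed_sideCoord {a b : ℂ} (h : a ≠ b) (x : ℂ) :
    sideEmbed a b (sideCoord a b x) = x := by
  have h0 : ‖b - a‖ ≠ 0 := norm_ne_zero_iff.2 (sub_ne_zero.2 h.symm)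
  have h1 := planeDot_self (b - a)
  set v := b - a with hv
  have h2 : planeDot v v ≠ 0 := by rw [h1]; positivity
  have h3 : sideEmbed a b (sideCoord a b x) = a + (planeDot v (x - a) / planeDot v v) • v
      + (planeDot (Complex.I * v) (x - a) / planeDot v v) • (Complex.I * v) := by
    simp only [sideEmbed, sideCoord, ← hv, h1, div_div, sq]
  rw [h3]
  obtain ⟨N, hN⟩ : ∃ N, N = v.re * v.re + v.im * v.im := ⟨_, rfl⟩
  have h4 : planeDot v v = N := by rw [hN, planeDot]
  rw [h4] at h2 ⊢
  apply Complex.ext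
  · simp only [planeDot, Complex.add_re, Complex.real_smul, Complex.mul_re, Complex.mul_im,
      Complex.I_re, Complex.I_im, Complex.ofReal_re, Complex.ofReal_im, Complex.sub_re,
      Complex.sub_im]
    field_simp
    rw [hN]
    ring
  · simp only [planeDot, Complex.add_im, Complex.real_smul, Complex.mul_re, Complex.mul_im,
      Complex.I_re, Complex.I_im, Complex.ofReal_re, Complex.ofReal_im, Complex.sub_re,
      Complex.sub_im]
    field_simp
    rw [hN]
    ring

theorem sideEmbed_injective {a b : ℂ} (h : a ≠ b) : Function.Injective (sideEmbed a b) :=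
  Function.LeftInverse.injective (sideCoord_sideEmbed h)

theorem isMonoArc_sideEmbed_genGraph {a b : ℂ} (h : a ≠ b) {φ : ℝ → ℝ}
    (hext : ∀ s, s ∉ Icc (0 : ℝ) ‖b - a‖ → φ s = 0)
    (hbv : BoundedVariationOn φ (Icc 0 ‖b - a‖)) :
    IsMonoArc (b - a) (sideEmbed a b '' genGraph φ ‖b - a‖) a b := by
  obtain ⟨A, B, c, hAB, hc, hi, him, hA, hB, hm⟩ := exists_param_genGraph (norm_nonneg _) hext hbv
  refine ⟨A, B, sideEmbed a b ∘ c, hAB, (sideEmbed_continuous a b).comp_continuousOn hc,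
    (sideEmbed_injective h).comp_injOn hi, by rw [image_comp, him], ?_, ?_, ?_⟩
  · simp [hA, sideEmbed_zero]
  · simp [hB, sideEmbed_length h]
  · intro r hr s hs hrs
    simp only [Function.comp_apply, planeDot_sideEmbed h]
    have := hm hr hs hrs
    simp only at this
    gcongr

/-- `K` is an arc from `a` to `p` which is totally ordered, increasingly from `a` to `p`, by both
components in the directions `d` and `e`. -/
structure IsChainArc (d e : ℂ) (K : Set ℂ) (a p : ℂ) : Prop where
  isCompact : IsCompact K
  left_mem : a ∈ K
  right_mem : p ∈ K
  left_le : ∀ x ∈ K, planeDot d a ≤ planeDot d x ∧ planeDot e a ≤ planeDot e x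
  le_right : ∀ x ∈ K, planeDot d x ≤ planeDot d p ∧ planeDot e x ≤ planeDot e p
  total : ∀ x ∈ K, ∀ y ∈ K, (planeDot d x ≤ planeDot d y ∧ planeDot e x ≤ planeDot e y) ∨
    (planeDot d y ≤ planeDot d x ∧ planeDot e y ≤ planeDot e x)
  full : ∀ t ∈ Icc (planeDot d a + planeDot e a) (planeDot d p + planeDot e p),
    ∃ x ∈ K, planeDot d x + planeDot e x = t

/-- Two injective parametrizations of the same arc with the same endpoints differ by an increasing
change of parameter. -/
theorem exists_strictMonoOn_comp_eq {A B A' B' : ℝ} {c γ : ℝ → ℂ} (hAB : A ≤ B)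
    (hc : ContinuousOn c (Icc A B)) (hi : InjOn c (Icc A B))
    (hγ : ContinuousOn γ (Icc A' B')) (hi' : InjOn γ (Icc A' B'))
    (him : c '' Icc A B = γ '' Icc A' B') (hAB' : A' ≤ B') (hA : c A = γ A') :
    ∃ τ : ℝ → ℝ, StrictMonoOn τ (Icc A B) ∧
      ∀ r ∈ Icc A B, τ r ∈ Icc A' B' ∧ γ (τ r) = c r := by
  have hex : ∀ r : Icc A B, ∃ t : Icc A' B', γ t = c r := fun r => by
    obtain ⟨t, ht, h⟩ : c r ∈ γ '' Icc A' B' := him ▸ mem_image_of_mem c r.2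
    exact ⟨⟨t, ht⟩, h⟩
  choose σ hσ using hex
  have hemb : IsClosedEmbedding ((Icc A' B').domRestrict γ) :=
    Continuous.isClosedEmbedding hγ.domRestrict hi'.injective
  have hσc : Continuous σ := by
    rw [hemb.isEmbedding.continuous_iff]
    have : (Icc A' B').domRestrict γ ∘ σ = (Icc A B).domRestrict c := by
      ext r; exact hσ r
    rw [this]
    exact hc.domRestrict
  have hval : ∀ r (hr : r ∈ Icc A B), projIcc A B hAB r = ⟨r, hr⟩ := fun r hr =>
    projIcc_of_mem hAB hr
  refine ⟨fun r => σ (projIcc A B hAB r), ?_, fun r hr => ⟨(σ _).2, ?_⟩⟩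
  · refine ContinuousOn.strictMonoOn_of_injOn_Icc hAB ?_
      (by fun_prop) ?_
    · have h : (σ (projIcc A B hAB A) : ℝ) = A' := by
        refine hi' (σ _).2 ⟨le_rfl, hAB'⟩ ?_
        rw [hσ, hval A ⟨le_rfl, hAB⟩, hA]
      rw [h]
      exact (σ _).2.1
    · intro r hr s hs hrs
      have := congrArg γ hrs
      simp only [hσ, hval r hr, hval s hs] at this
      exact hi hr hs this
  · rw [hσ, hval r hr]

theorem IsMonoArc.isChainArc {d e : ℂ} {K : Set ℂ} {a p : ℂ} (h : IsMonoArc d K a p)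
    (h' : IsMonoArc e K a p) : IsChainArc d e K a p := by
  have hK := h.isCompact
  obtain ⟨A, B, c, hAB, hc, hi, rfl, rfl, rfl, hm⟩ := h
  obtain ⟨A', B', c', hAB', hc', hi', him, hA', hB', hm'⟩ := h'
  obtain ⟨τ, hτ, hτc⟩ := exists_strictMonoOn_comp_eq hAB hc hi hc' hi' him.symm hAB' hA'.symm
  have hmono : ∀ r ∈ Icc A B, ∀ s ∈ Icc A B, r ≤ s →
      planeDot d (c r) ≤ planeDot d (c s) ∧ planeDot e (c r) ≤ planeDot e (c s) := by
    intro r hr s hs hrs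
    refine ⟨hm hr hs hrs, ?_⟩
    have := hm' (hτc r hr).1 (hτc s hs).1 (hτ.monotoneOn hr hs hrs)
    simpa only [(hτc r hr).2, (hτc s hs).2] using this
  have hAI : A ∈ Icc A B := ⟨le_rfl, hAB⟩
  have hBI : B ∈ Icc A B := ⟨hAB, le_rfl⟩
  refine ⟨hK, mem_image_of_mem c hAI, mem_image_of_mem c hBI, ?_, ?_, ?_, ?_⟩
  · rintro _ ⟨r, hr, rfl⟩
    exact hmono A hAI r hr hr.1
  · rintro _ ⟨r, hr, rfl⟩
    exact hmono r hr B hBI hr.2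
  · rintro _ ⟨r, hr, rfl⟩ _ ⟨s, hs, rfl⟩
    exact (le_total r s).imp (hmono r hr s hs) (hmono s hs r hr)
  · intro t ht
    have hw : ContinuousOn (fun r => planeDot d (c r) + planeDot e (c r)) (Icc A B) :=
      ((continuous_planeDot d).comp_continuousOn hc).add
        ((continuous_planeDot e).comp_continuousOn hc)
    obtain ⟨r, hr, hrt⟩ := intermediate_value_Icc hAB hw ht
    exact ⟨c r, mem_image_of_mem c hr, hrt⟩

/-- The cross product of plane vectors. -/
def planeCross (d e : ℂ) : ℝ := d.re * e.im - d.im * e.re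

theorem eq_of_planeDot_eq {d e : ℂ} (h : planeCross d e ≠ 0) {x y : ℂ}
    (hd : planeDot d x = planeDot d y) (he : planeDot e x = planeDot e y) : x = y := by
  simp only [planeDot, planeCross] at *
  apply Complex.ext
  · apply mul_left_cancel₀ h; linear_combination e.im * hd - d.im * he
  · apply mul_left_cancel₀ h; linear_combination d.re * he - e.re * hd

/-- Independent components control the norm. -/
theorem exists_norm_le_planeDot {d e : ℂ} (h : planeCross d e ≠ 0) :
    ∃ C : ℝ, 0 ≤ C ∧ ∀ x : ℂ, ‖x‖ ≤ C * (|planeDot d x| + |planeDot e x|) := by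
  set D := planeCross d e with hD
  refine ⟨(‖d‖ + ‖e‖) * 2 / |D|, by positivity, fun x => ?_⟩
  have hDp : 0 < |D| := abs_pos.2 h
  have hre : |D| * |x.re| ≤ (‖d‖ + ‖e‖) * (|planeDot d x| + |planeDot e x|) := by
    rw [← abs_mul]
    have : D * x.re = e.im * planeDot d x - d.im * planeDot e x := by
      simp only [hD, planeDot, planeCross]; ring
    rw [this]
    refine (abs_sub _ _).trans ?_
    rw [abs_mul, abs_mul]
    have h1 := Complex.abs_im_le_norm e
    have h2 := Complex.abs_im_le_norm d
    nlinarith [abs_nonneg (planeDot d x), abs_nonneg (planeDot e x), norm_nonneg d, norm_nonneg e,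
      mul_le_mul_of_nonneg_right h1 (abs_nonneg (planeDot d x)),
      mul_le_mul_of_nonneg_right h2 (abs_nonneg (planeDot e x))]
  have him : |D| * |x.im| ≤ (‖d‖ + ‖e‖) * (|planeDot d x| + |planeDot e x|) := by
    rw [← abs_mul]
    have : D * x.im = d.re * planeDot e x - e.re * planeDot d x := by
      simp only [hD, planeDot, planeCross]; ring
    rw [this]
    refine (abs_sub _ _).trans ?_
    rw [abs_mul, abs_mul]
    have h1 := Complex.abs_re_le_norm e
    have h2 := Complex.abs_re_le_norm d
    nlinarith [abs_nonneg (planeDot d x), abs_nonneg (planeDot e x), norm_nonneg d, norm_nonneg e,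
      mul_le_mul_of_nonneg_right h1 (abs_nonneg (planeDot d x)),
      mul_le_mul_of_nonneg_right h2 (abs_nonneg (planeDot e x))]
  have h3 := Complex.norm_le_abs_re_add_abs_im x
  rw [div_mul_eq_mul_div, le_div_iff₀ hDp]
  nlinarith

namespace IsChainArc

variable {d e : ℂ} {K : Set ℂ} {a p : ℂ}

theorem le_of_weight_le (h : IsChainArc d e K a p) {x y : ℂ} (hx : x ∈ K) (hy : y ∈ K)
    (hxy : planeDot d x + planeDot e x ≤ planeDot d y + planeDot e y) :
    planeDot d x ≤ planeDot d y ∧ planeDot e x ≤ planeDot e y := by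
  rcases h.total x hx y hy with h' | h'
  · exact h'
  · exact ⟨by linarith [h'.1, h'.2], by linarith [h'.1, h'.2]⟩

theorem eq_of_weight_eq (h : IsChainArc d e K a p) (hde : planeCross d e ≠ 0) {x y : ℂ}
    (hx : x ∈ K) (hy : y ∈ K)
    (hxy : planeDot d x + planeDot e x = planeDot d y + planeDot e y) : x = y := by
  have h1 := h.le_of_weight_le hx hy hxy.le
  have h2 := h.le_of_weight_le hy hx hxy.ge
  exact eq_of_planeDot_eq hde (le_antisymm h1.1 h2.1) (le_antisymm h1.2 h2.2)

theorem subset_image (h : IsChainArc d e K a p) {x : ℂ} (hx : x ∈ K) :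
    planeDot d x + planeDot e x ∈
      Icc (planeDot d a + planeDot e a) (planeDot d p + planeDot e p) := by
  have h1 := h.left_le x hx
  have h2 := h.le_right x hx
  constructor <;> linarith [h1.1, h1.2, h2.1, h2.2]

/-- A chain arc has a Lipschitz parametrization by the sum of its two components. -/
theorem exists_lipschitz_param (h : IsChainArc d e K a p) (hde : planeCross d e ≠ 0) :
    ∃ γ : ℝ → ℂ, ∃ C : NNReal,
      LipschitzOnWith C γ (Icc (planeDot d a + planeDot e a) (planeDot d p + planeDot e p)) ∧
      γ '' Icc (planeDot d a + planeDot e a) (planeDot d p + planeDot e p) = K ∧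
      (∀ t ∈ Icc (planeDot d a + planeDot e a) (planeDot d p + planeDot e p),
        planeDot d (γ t) + planeDot e (γ t) = t) := by
  have hf := h.full
  choose! γ hγ hw using hf
  obtain ⟨C, hC, hn⟩ := exists_norm_le_planeDot hde
  refine ⟨γ, ⟨C, hC⟩, ?_, ?_, hw⟩
  · refine LipschitzOnWith.of_dist_le_mul fun s hs t ht => ?_
    wlog hst : t ≤ s generalizing s t
    · rw [dist_comm, dist_comm s t]; exact this t ht s hs (le_of_not_ge hst)
    have hle := h.le_of_weight_le (hγ t ht) (hγ s hs) (by rw [hw t ht, hw s hs]; exact hst)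
    have := hn (γ s - γ t)
    rw [planeDot_sub, planeDot_sub, abs_of_nonneg (by linarith [hle.1]),
      abs_of_nonneg (by linarith [hle.2])] at this
    rw [dist_eq_norm, Real.dist_eq, abs_of_nonneg (by linarith)]
    refine this.trans (le_of_eq ?_)
    change C * _ = C * _
    congr 1
    linarith [hw t ht, hw s hs]
  · refine Subset.antisymm (image_subset_iff.2 hγ) fun x hx => ⟨_, h.subset_image hx, ?_⟩
    exact h.eq_of_weight_eq hde (hγ _ (h.subset_image hx)) hx (hw _ (h.subset_image hx))

end IsChainArc

/-- Convergence of a sequence of sets in the sense of Kuratowski. -/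
structure KuratowskiLim (Kn : ℕ → Set ℂ) (K : Set ℂ) : Prop where
  lower : ∀ x ∈ K, ∃ u : ℕ → ℂ, (∀ n, u n ∈ Kn n) ∧ Tendsto u atTop (𝓝 x)
  upper : ∀ ns : ℕ → ℕ, StrictMono ns → ∀ u : ℕ → ℂ, (∀ k, u k ∈ Kn (ns k)) →
    ∀ x, Tendsto u atTop (𝓝 x) → x ∈ K

theorem kuratowskiLim_of_tendsto {Kn : ℕ → TopologicalSpace.NonemptyCompacts ℂ}
    {K : TopologicalSpace.NonemptyCompacts ℂ} (h : Tendsto Kn atTop (𝓝 K)) :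
    KuratowskiLim (fun n => (Kn n : Set ℂ)) K := by
  constructor
  · intro x hx
    have h1 : Tendsto (fun n => Metric.infDist x (Kn n : Set ℂ)) atTop
        (𝓝 (Metric.infDist x (K : Set ℂ))) :=
      ((Metric.lipschitz_infDist_set x).continuous.tendsto K).comp h
    rw [Metric.infDist_zero_of_mem hx] at h1
    choose u hu hux using fun n => (Kn n).isCompact.exists_infDist_eq_dist (Kn n).nonempty x
    refine ⟨u, hu, ?_⟩
    rw [tendsto_iff_dist_tendsto_zero]
    refine h1.congr fun n => ?_
    rw [hux, dist_comm]
  · intro ns hns u hu x hx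
    have h1 : Tendsto (fun k => Metric.infDist (u k) (K : Set ℂ)) atTop
        (𝓝 (Metric.infDist x (K : Set ℂ))) :=
      ((Metric.continuous_infDist_pt (K : Set ℂ)).tendsto x).comp hx
    have h0 : Tendsto (fun k => dist (Kn (ns k)) K) atTop (𝓝 0) :=
      (tendsto_iff_dist_tendsto_zero.1 h).comp hns.tendsto_atTop
    have h2 : Metric.infDist x (K : Set ℂ) = 0 := by
      refine tendsto_nhds_unique h1 (squeeze_zero (fun _ => Metric.infDist_nonneg) (fun k => ?_) h0)
      rw [Metric.NonemptyCompacts.dist_eq]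
      exact Metric.infDist_le_hausdorffDist_of_mem (hu k)
        (Metric.hausdorffEDist_ne_top_of_nonempty_of_bounded (Kn (ns k)).nonempty K.nonempty
          (Kn (ns k)).isCompact.isBounded K.isCompact.isBounded)
    exact (K.isCompact.isClosed.mem_iff_infDist_zero K.nonempty).2 h2

theorem KuratowskiLim.union {Kn Ln : ℕ → Set ℂ} {K L : Set ℂ} (hK : KuratowskiLim Kn K)
    (hL : KuratowskiLim Ln L) : KuratowskiLim (fun n => Kn n ∪ Ln n) (K ∪ L) := by
  constructor
  · rintro x (hx | hx)
    · obtain ⟨u, hu, h⟩ := hK.lower x hx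
      exact ⟨u, fun n => Or.inl (hu n), h⟩
    · obtain ⟨u, hu, h⟩ := hL.lower x hx
      exact ⟨u, fun n => Or.inr (hu n), h⟩
  · intro ns hns u hu x hx
    by_cases hf : ∃ᶠ k in atTop, u k ∈ Kn (ns k)
    · obtain ⟨ms, hms, h⟩ := extraction_of_frequently_atTop hf
      exact Or.inl (hK.upper (ns ∘ ms) (hns.comp hms) (u ∘ ms) h x (hx.comp hms.tendsto_atTop))
    · have hf' : ∃ᶠ k in atTop, u k ∈ Ln (ns k) :=
        ((not_frequently.1 hf).mono fun k hk => (hu k).resolve_left hk).frequently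
      obtain ⟨ms, hms, h⟩ := extraction_of_frequently_atTop hf'
      exact Or.inr (hL.upper (ns ∘ ms) (hns.comp hms) (u ∘ ms) h x (hx.comp hms.tendsto_atTop))

theorem isChainArc_of_kuratowskiLim {d e a p : ℂ} {T K : Set ℂ} (hT : IsCompact T)
    {Kn : ℕ → Set ℂ} {pn : ℕ → ℂ} (hKT : ∀ n, Kn n ⊆ T)
    (hn : ∀ n, IsChainArc d e (Kn n) a (pn n)) (hK : IsCompact K) (hlim : KuratowskiLim Kn K)
    (hp : Tendsto pn atTop (𝓝 p)) : IsChainArc d e K a p := by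
  have hd := continuous_planeDot d
  have he := continuous_planeDot e
  have td := fun (u : ℕ → ℂ) x (h : Tendsto u atTop (𝓝 x)) => (hd.tendsto x).comp h
  have te := fun (u : ℕ → ℂ) x (h : Tendsto u atTop (𝓝 x)) => (he.tendsto x).comp h
  refine ⟨hK, hlim.upper id strictMono_id _ (fun n => (hn n).left_mem) a tendsto_const_nhds,
    hlim.upper id strictMono_id _ (fun n => (hn n).right_mem) p hp, ?_, ?_, ?_, ?_⟩
  · intro x hx
    obtain ⟨u, hu, hux⟩ := hlim.lower x hx
    exact ⟨ge_of_tendsto' (td u x hux) fun n => ((hn n).left_le _ (hu n)).1,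
      ge_of_tendsto' (te u x hux) fun n => ((hn n).left_le _ (hu n)).2⟩
  · intro x hx
    obtain ⟨u, hu, hux⟩ := hlim.lower x hx
    exact ⟨le_of_tendsto_of_tendsto' (td u x hux) (td pn p hp)
        fun n => ((hn n).le_right _ (hu n)).1,
      le_of_tendsto_of_tendsto' (te u x hux) (te pn p hp) fun n => ((hn n).le_right _ (hu n)).2⟩
  · intro x hx y hy
    obtain ⟨u, hu, hux⟩ := hlim.lower x hx
    obtain ⟨v, hv, hvy⟩ := hlim.lower y hy
    have hcl : IsClosed {z : ℂ × ℂ |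
        (planeDot d z.1 ≤ planeDot d z.2 ∧ planeDot e z.1 ≤ planeDot e z.2) ∨
        (planeDot d z.2 ≤ planeDot d z.1 ∧ planeDot e z.2 ≤ planeDot e z.1)} := by
      simp only [ofPred_or, ofPred_and]
      exact ((isClosed_le (hd.comp continuous_fst) (hd.comp continuous_snd)).inter
        (isClosed_le (he.comp continuous_fst) (he.comp continuous_snd))).union
        ((isClosed_le (hd.comp continuous_snd) (hd.comp continuous_fst)).inter
        (isClosed_le (he.comp continuous_snd) (he.comp continuous_fst)))
    exact hcl.mem_of_tendsto (hux.prodMk_nhds hvy)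
      (Eventually.of_forall fun n => (hn n).total _ (hu n) _ (hv n))
  · intro t ht
    have hw : Continuous fun x => planeDot d x + planeDot e x := hd.add he
    choose u hu hut using fun n => (hn n).full
      (max (planeDot d a + planeDot e a) (min t (planeDot d (pn n) + planeDot e (pn n))))
      ⟨le_max_left _ _, max_le (by
        have := (hn n).left_le _ (hn n).right_mem
        linarith [this.1, this.2]) (min_le_right _ _)⟩
    obtain ⟨x, -, ms, hms, hx⟩ := hT.tendsto_subseq fun n => hKT n (hu n)
    refine ⟨x, hlim.upper ms hms _ (fun k => hu _) x hx, ?_⟩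
    refine tendsto_nhds_unique ((hw.tendsto x).comp hx) ?_
    have h1 : Tendsto (fun n => max (planeDot d a + planeDot e a)
        (min t (planeDot d (pn n) + planeDot e (pn n)))) atTop (𝓝 t) := by
      have := (tendsto_const_nhds (x := planeDot d a + planeDot e a)).max
        ((tendsto_const_nhds (x := t)).min ((hw.tendsto p).comp hp))
      rwa [min_eq_left ht.2, max_eq_right ht.1] at this
    refine (h1.comp hms.tendsto_atTop).congr fun k => ?_
    simp only [Function.comp_apply, hut]

theorem planeDot_sum_eq_zero {d₁ d₂ d₃ : ℂ} (h : d₁ + d₂ + d₃ = 0) (x : ℂ) :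
    planeDot d₁ x + planeDot d₂ x + planeDot d₃ x = 0 := by
  obtain rfl : d₃ = -d₁ - d₂ := by linear_combination h
  simp [planeDot]; ring

theorem planeCross_rotate {d₁ d₂ d₃ : ℂ} (h : d₁ + d₂ + d₃ = 0) :
    planeCross d₂ d₃ = planeCross d₁ d₂ := by
  obtain rfl : d₃ = -d₁ - d₂ := by linear_combination h
  simp [planeCross]; ring

theorem planeCross_neg_right (d e : ℂ) : planeCross d (-e) = -planeCross d e := by
  simp [planeCross]; ring

theorem planeCross_comm (d e : ℂ) : planeCross d e = -planeCross e d := by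
  simp [planeCross]; ring

/-- The initial part of a chain arc up to one of its points is a chain arc. -/
theorem IsChainArc.initial {d e : ℂ} {K : Set ℂ} {a p q : ℂ} (h : IsChainArc d e K a p)
    (hq : q ∈ K) :
    IsChainArc d e {x ∈ K | planeDot d x + planeDot e x ≤ planeDot d q + planeDot e q} a q := by
  have hql := h.left_le q hq
  have hqr := h.le_right q hq
  refine ⟨h.isCompact.inter_right (isClosed_le
      ((continuous_planeDot d).add (continuous_planeDot e)) continuous_const),
    ⟨h.left_mem, by linarith [hql.1, hql.2]⟩, ⟨hq, le_rfl⟩, fun x hx => h.left_le x hx.1,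
    fun x hx => h.le_of_weight_le hx.1 hq hx.2, fun x hx y hy => h.total x hx.1 y hy.1, ?_⟩
  intro t ht
  obtain ⟨x, hx, hxt⟩ := h.full t ⟨ht.1, ht.2.trans (by linarith [hqr.1, hqr.2])⟩
  exact ⟨x, ⟨hx, hxt ▸ ht.2⟩, hxt⟩

theorem exists_planeDot_of_mem_segment {p q x : ℂ} (hx : x ∈ segment ℝ p q) :
    ∃ θ ∈ Icc (0 : ℝ) 1, ∀ d, planeDot d x = planeDot d p + θ * (planeDot d q - planeDot d p) := by
  rw [segment_eq_image'] at hx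
  obtain ⟨θ, hθ, rfl⟩ := hx
  exact ⟨θ, hθ, fun d => by simp [planeDot]; ring⟩

theorem exists_mem_segment_planeDot (p q : ℂ) {θ : ℝ} (hθ : θ ∈ Icc (0 : ℝ) 1) :
    ∃ x ∈ segment ℝ p q, ∀ d, planeDot d x = planeDot d p + θ * (planeDot d q - planeDot d p) :=
  ⟨p + θ • (q - p), by rw [segment_eq_image']; exact ⟨θ, hθ, rfl⟩,
    fun d => by simp [planeDot]; ring⟩

/-- A chain arc can be prolonged by a segment in an admissible direction. -/
theorem IsChainArc.union_segment {d e : ℂ} {K : Set ℂ} {a p q : ℂ} (h : IsChainArc d e K a p)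
    (hd : planeDot d p ≤ planeDot d q) (he : planeDot e p ≤ planeDot e q) :
    IsChainArc d e (K ∪ segment ℝ p q) a q := by
  have hseg : ∀ x ∈ segment ℝ p q, planeDot d p ≤ planeDot d x ∧ planeDot d x ≤ planeDot d q ∧
      planeDot e p ≤ planeDot e x ∧ planeDot e x ≤ planeDot e q := fun x hx => by
    obtain ⟨θ, hθ, h⟩ := exists_planeDot_of_mem_segment hx
    rw [h d, h e]
    have h1 := sub_nonneg.2 hd
    have h2 := sub_nonneg.2 he
    refine ⟨?_, ?_, ?_, ?_⟩ <;> nlinarith [hθ.1, hθ.2]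
  refine ⟨h.isCompact.union ?_, Or.inl h.left_mem, Or.inr (right_mem_segment ℝ p q), ?_, ?_, ?_, ?_⟩
  · rw [segment_eq_image']
    exact isCompact_Icc.image (by fun_prop)
  · rintro x (hx | hx)
    · exact h.left_le x hx
    · have h1 := hseg x hx
      have h2 := h.left_le p h.right_mem
      exact ⟨h2.1.trans h1.1, h2.2.trans h1.2.2.1⟩
  · rintro x (hx | hx)
    · have := h.le_right x hx
      exact ⟨this.1.trans hd, this.2.trans he⟩
    · exact ⟨(hseg x hx).2.1, (hseg x hx).2.2.2⟩
  · rintro x (hx | hx) y (hy | hy)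
    · exact h.total x hx y hy
    · have h1 := h.le_right x hx
      have h2 := hseg y hy
      exact Or.inl ⟨h1.1.trans h2.1, h1.2.trans h2.2.2.1⟩
    · have h1 := h.le_right y hy
      have h2 := hseg x hx
      exact Or.inr ⟨h1.1.trans h2.1, h1.2.trans h2.2.2.1⟩
    · obtain ⟨θ, hθ, h1⟩ := exists_planeDot_of_mem_segment hx
      obtain ⟨η, hη, h2⟩ := exists_planeDot_of_mem_segment hy
      simp only [h1, h2]
      rcases le_total θ η with h | h
      · left
        constructor <;> gcongr
      · right
        constructor <;> gcongr
  · intro t ht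
    rcases le_total t (planeDot d p + planeDot e p) with h1 | h1
    · obtain ⟨x, hx, hxt⟩ := h.full t ⟨ht.1, h1⟩
      exact ⟨x, Or.inl hx, hxt⟩
    · rcases (show planeDot d p + planeDot e p ≤ planeDot d q + planeDot e q by
        linarith).eq_or_lt with h2 | h2
      · exact ⟨p, Or.inl h.right_mem, le_antisymm h1 (h2 ▸ ht.2)⟩
      · have h3 := sub_pos.2 h2
        obtain ⟨x, hx, hxd⟩ := exists_mem_segment_planeDot p q
          (θ := (t - (planeDot d p + planeDot e p)) /
            (planeDot d q + planeDot e q - (planeDot d p + planeDot e p)))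
          ⟨div_nonneg (by linarith) h3.le, (div_le_one h3).2 (by linarith [ht.2])⟩
        refine ⟨x, Or.inr hx, ?_⟩
        rw [hxd d, hxd e]
        field_simp
        ring

theorem mem_segment_of_planeDot {d e : ℂ} (h : planeCross d e ≠ 0) {p q x : ℂ}
    (hq : planeDot d q = planeDot d p) (hx : planeDot d x = planeDot d p)
    (h1 : planeDot e p ≤ planeDot e x) (h2 : planeDot e x ≤ planeDot e q) :
    x ∈ segment ℝ p q := by
  rcases (h1.trans h2).eq_or_lt with h3 | h3
  · rw [eq_of_planeDot_eq h hx (le_antisymm (h3 ▸ h2) h1)]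
    exact left_mem_segment ℝ p q
  · have h4 := sub_pos.2 h3
    obtain ⟨y, hy, hyd⟩ := exists_mem_segment_planeDot p q
      (θ := (planeDot e x - planeDot e p) / (planeDot e q - planeDot e p))
      ⟨div_nonneg (by linarith) h4.le, (div_le_one h4).2 (by linarith)⟩
    have : x = y := by
      refine eq_of_planeDot_eq h ?_ ?_
      · rw [hyd, hq, hx]; ring
      · rw [hyd]; field_simp; ring
    rwa [this]

/-- The three arcs `K₁, K₂, K₃` can be modified, only along the heights through `p`, to three arcs
in `T` meeting exactly at one point. -/
def HasTriplePoint (T : Set ℂ) (d₁ d₂ d₃ : ℂ) (K₁ K₂ K₃ : Set ℂ) (a₁ a₂ a₃ p : ℂ) : Prop :=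
  ∃ (q : ℂ) (G₁ G₂ G₃ : Set ℂ), IsChainArc d₁ (-d₃) G₁ a₁ q ∧ IsChainArc d₂ (-d₁) G₂ a₂ q ∧
    IsChainArc d₃ (-d₂) G₃ a₃ q ∧ G₁ ⊆ T ∧ G₂ ⊆ T ∧ G₃ ⊆ T ∧
    G₁ ∩ G₂ = {q} ∧ G₂ ∩ G₃ = {q} ∧ G₃ ∩ G₁ = {q} ∧
    K₁ ∪ K₂ ⊆ G₁ ∪ G₂ ∪ {x | planeDot d₁ x = planeDot d₁ p} ∧
    K₂ ∪ K₃ ⊆ G₂ ∪ G₃ ∪ {x | planeDot d₂ x = planeDot d₂ p} ∧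
    K₃ ∪ K₁ ⊆ G₃ ∪ G₁ ∪ {x | planeDot d₃ x = planeDot d₃ p}

theorem HasTriplePoint.rotate {T : Set ℂ} {d₁ d₂ d₃ : ℂ} {K₁ K₂ K₃ : Set ℂ} {a₁ a₂ a₃ p : ℂ}
    (h : HasTriplePoint T d₁ d₂ d₃ K₁ K₂ K₃ a₁ a₂ a₃ p) :
    HasTriplePoint T d₂ d₃ d₁ K₂ K₃ K₁ a₂ a₃ a₁ p := by
  obtain ⟨q, G₁, G₂, G₃, h1, h2, h3, t1, t2, t3, i1, i2, i3, s1, s2, s3⟩ := h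
  exact ⟨q, G₂, G₃, G₁, h2, h3, h1, t2, t3, t1, i2, i3, i1, s2, s3, s1⟩

theorem hasTriplePoint_of_exists_ne {T : Set ℂ} (hT : Convex ℝ T) {d₁ d₂ d₃ : ℂ}
    (hs : d₁ + d₂ + d₃ = 0) (hD : planeCross d₁ d₂ ≠ 0)
    {K₁ K₂ K₃ : Set ℂ} {a₁ a₂ a₃ p : ℂ} (h₁ : IsChainArc d₁ (-d₃) K₁ a₁ p)
    (h₂ : IsChainArc d₂ (-d₁) K₂ a₂ p) (h₃ : IsChainArc d₃ (-d₂) K₃ a₃ p) (t₁ : K₁ ⊆ T)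
    (t₂ : K₂ ⊆ T) (t₃ : K₃ ⊆ T) (hne : ∃ x ∈ K₁ ∩ K₂, x ≠ p) :
    HasTriplePoint T d₁ d₂ d₃ K₁ K₂ K₃ a₁ a₂ a₃ p := by
  have hsum := planeDot_sum_eq_zero hs
  have hD23 : planeCross d₂ d₃ ≠ 0 := by rwa [planeCross_rotate hs]
  have hD13 : planeCross d₁ d₃ ≠ 0 := by
    rw [planeCross_comm, planeCross_rotate (d₁ := d₂) (by linear_combination hs)]
    exact neg_ne_zero.2 hD23
  have R₁ := fun x hx => h₁.le_right x hx
  have R₂ := fun x hx => h₂.le_right x hx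
  have R₃ := fun x hx => h₃.le_right x hx
  simp only [planeDot_neg, neg_le_neg_iff] at R₁ R₂ R₃
  obtain ⟨q, ⟨hq1, hq2⟩, hqmin⟩ := (h₁.isCompact.inter h₂.isCompact).exists_isMinOn
    (hne.imp fun x hx => hx.1)
    ((continuous_planeDot d₁).add (continuous_planeDot (-d₃))).continuousOn
  have hqmin' : ∀ x ∈ K₁ ∩ K₂, planeDot d₁ q - planeDot d₃ q ≤ planeDot d₁ x - planeDot d₃ x := by
    intro x hx
    have := hqmin hx
    simpa [planeDot_neg, sub_eq_add_neg] using this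
  have hline : ∀ x ∈ K₁ ∩ K₂, planeDot d₁ x = planeDot d₁ p := fun x hx =>
    le_antisymm (R₁ x hx.1).1 (R₂ x hx.2).2
  have hqd1 := hline q ⟨hq1, hq2⟩
  have hqp : q ≠ p := by
    rintro rfl
    obtain ⟨x, hx, hxq⟩ := hne
    have h4 := hqmin' x hx
    have h5 := R₁ x hx.1
    have h6 := hline x hx
    exact hxq (eq_of_planeDot_eq hD13 h6 (by linarith [h5.2]))
  have hq3 : planeDot d₃ p < planeDot d₃ q := (R₁ q hq1).2.lt_of_ne fun h =>
    hqp (eq_of_planeDot_eq hD13 hqd1 h.symm)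
  have hq2' : planeDot d₂ q < planeDot d₂ p := by linarith [hsum p, hsum q]
  have hseg : ∀ x ∈ segment ℝ p q, planeDot d₁ x = planeDot d₁ p ∧ planeDot d₃ x ≤ planeDot d₃ q :=
    fun x hx => by
      obtain ⟨θ, hθ, h⟩ := exists_planeDot_of_mem_segment hx
      rw [h, h, hqd1]
      exact ⟨by ring, by nlinarith [hθ.1, hθ.2]⟩
  have hseg1 : ∀ x ∈ K₁, planeDot d₁ q + planeDot (-d₃) q ≤ planeDot d₁ x + planeDot (-d₃) x →
      x ∈ segment ℝ p q := fun x hx hxq => by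
    have h4 := h₁.le_of_weight_le hq1 hx hxq
    have h5 := R₁ x hx
    simp only [planeDot_neg, neg_le_neg_iff] at h4
    exact mem_segment_of_planeDot hD13 hqd1 (by linarith [h4.1, h5.1]) h5.2 h4.2
  have hseg2 : ∀ x ∈ K₂, planeDot d₂ q + planeDot (-d₁) q ≤ planeDot d₂ x + planeDot (-d₁) x →
      x ∈ segment ℝ p q := fun x hx hxq => by
    have h4 := h₂.le_of_weight_le hq2 hx hxq
    have h5 := R₂ x hx
    simp only [planeDot_neg, neg_le_neg_iff] at h4
    have h6 : planeDot d₁ x = planeDot d₁ p := by linarith [h4.2, h5.2]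
    exact mem_segment_of_planeDot hD13 hqd1 h6 (by linarith [hsum x, hsum p, h5.1])
      (by linarith [hsum x, hsum q, h4.1])
  have G₁ := h₁.initial hq1
  have G₂ := h₂.initial hq2
  have G₃ : IsChainArc d₃ (-d₂) (K₃ ∪ segment ℝ p q) a₃ q := h₃.union_segment hq3.le
    (by simp only [planeDot_neg]; linarith)
  refine ⟨q, _, _, _, G₁, G₂, G₃, (sep_subset _ _).trans t₁, (sep_subset _ _).trans t₂,
    union_subset t₃ (hT.segment_subset (t₁ h₁.right_mem) (t₁ hq1)), ?_, ?_, ?_, ?_, ?_, ?_⟩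
  · refine Subset.antisymm (fun x hx => ?_) (singleton_subset_iff.2 ⟨G₁.right_mem, G₂.right_mem⟩)
    have h4 := hx.1.2
    have h5 := hqmin' x ⟨hx.1.1, hx.2.1⟩
    simp only [planeDot_neg] at h4
    exact h₁.eq_of_weight_eq (by rw [planeCross_neg_right]; exact neg_ne_zero.2 hD13) hx.1.1 hq1
      (by simp only [planeDot_neg]; linarith)
  · refine Subset.antisymm (fun x hx => ?_) (singleton_subset_iff.2 ⟨G₂.right_mem, G₃.right_mem⟩)
    have h4 := h₂.le_of_weight_le hx.1.1 hq2 hx.1.2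
    simp only [planeDot_neg, neg_le_neg_iff] at h4
    rcases hx.2 with hx3 | hx3
    · have := (R₃ x hx3).2
      linarith [h4.1]
    · have := hseg x hx3
      exact eq_of_planeDot_eq hD13 (by linarith)
        (by linarith [hsum x, hsum q, h4.1, this.1, this.2])
  · refine Subset.antisymm (fun x hx => ?_) (singleton_subset_iff.2 ⟨G₃.right_mem, G₁.right_mem⟩)
    have h4 := h₁.le_of_weight_le hx.2.1 hq1 hx.2.2
    simp only [planeDot_neg, neg_le_neg_iff] at h4
    rcases hx.1 with hx3 | hx3
    · have := (R₃ x hx3).1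
      linarith [h4.2]
    · have := hseg x hx3
      exact eq_of_planeDot_eq hD13 (by linarith) (by linarith [h4.2, this.2])
  · rintro x (hx | hx)
    · rcases le_total (planeDot d₁ x + planeDot (-d₃) x) (planeDot d₁ q + planeDot (-d₃) q) with h | h
      · exact Or.inl (Or.inl ⟨hx, h⟩)
      · exact Or.inr (hseg x (hseg1 x hx h)).1
    · rcases le_total (planeDot d₂ x + planeDot (-d₁) x) (planeDot d₂ q + planeDot (-d₁) q) with h | h
      · exact Or.inl (Or.inr ⟨hx, h⟩)
      · exact Or.inr (hseg x (hseg2 x hx h)).1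
  · rintro x (hx | hx)
    · rcases le_total (planeDot d₂ x + planeDot (-d₁) x) (planeDot d₂ q + planeDot (-d₁) q) with h | h
      · exact Or.inl (Or.inl ⟨hx, h⟩)
      · exact Or.inl (Or.inr (Or.inr (hseg2 x hx h)))
    · exact Or.inl (Or.inr (Or.inl hx))
  · rintro x (hx | hx)
    · exact Or.inl (Or.inl (Or.inl hx))
    · rcases le_total (planeDot d₁ x + planeDot (-d₃) x) (planeDot d₁ q + planeDot (-d₃) q) with h | h
      · exact Or.inl (Or.inr ⟨hx, h⟩)
      · exact Or.inl (Or.inl (Or.inr (hseg1 x hx h)))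

theorem hasTriplePoint {T : Set ℂ} (hT : Convex ℝ T) {d₁ d₂ d₃ : ℂ}
    (hs : d₁ + d₂ + d₃ = 0) (hD : planeCross d₁ d₂ ≠ 0)
    {K₁ K₂ K₃ : Set ℂ} {a₁ a₂ a₃ p : ℂ} (h₁ : IsChainArc d₁ (-d₃) K₁ a₁ p)
    (h₂ : IsChainArc d₂ (-d₁) K₂ a₂ p) (h₃ : IsChainArc d₃ (-d₂) K₃ a₃ p) (t₁ : K₁ ⊆ T)
    (t₂ : K₂ ⊆ T) (t₃ : K₃ ⊆ T) : HasTriplePoint T d₁ d₂ d₃ K₁ K₂ K₃ a₁ a₂ a₃ p := by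
  have hs2 : d₂ + d₃ + d₁ = 0 := by linear_combination hs
  have hs3 : d₃ + d₁ + d₂ = 0 := by linear_combination hs
  have hD2 : planeCross d₂ d₃ ≠ 0 := by rwa [planeCross_rotate hs]
  have hD3 : planeCross d₃ d₁ ≠ 0 := by rwa [planeCross_rotate hs2]
  by_cases h12 : ∃ x ∈ K₁ ∩ K₂, x ≠ p
  · exact hasTriplePoint_of_exists_ne hT hs hD h₁ h₂ h₃ t₁ t₂ t₃ h12
  by_cases h23 : ∃ x ∈ K₂ ∩ K₃, x ≠ p
  · exact (hasTriplePoint_of_exists_ne hT hs2 hD2 h₂ h₃ h₁ t₂ t₃ t₁ h23).rotate.rotate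
  by_cases h31 : ∃ x ∈ K₃ ∩ K₁, x ≠ p
  · exact (hasTriplePoint_of_exists_ne hT hs3 hD3 h₃ h₁ h₂ t₃ t₁ t₂ h31).rotate
  push Not at h12 h23 h31
  exact ⟨p, K₁, K₂, K₃, h₁, h₂, h₃, t₁, t₂, t₃,
    eq_singleton_iff_unique_mem.2 ⟨⟨h₁.right_mem, h₂.right_mem⟩, h12⟩,
    eq_singleton_iff_unique_mem.2 ⟨⟨h₂.right_mem, h₃.right_mem⟩, h23⟩,
    eq_singleton_iff_unique_mem.2 ⟨⟨h₃.right_mem, h₁.right_mem⟩, h31⟩,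
    subset_union_left, subset_union_left, subset_union_left⟩

/-- A simple rectifiable arc in the plane with nondecreasing first coordinate, joining `(0, 0)` to
`(l, 0)`, is the generalized graph of a function of bounded variation. -/
theorem exists_genGraph_eq_image {A B l : ℝ} {f g : ℝ → ℝ} (hl : 0 < l) (hAB : A ≤ B)
    (hf : ContinuousOn f (Icc A B)) (hg : ContinuousOn g (Icc A B))
    (hinj : InjOn (fun r => (f r, g r)) (Icc A B)) (hm : MonotoneOn f (Icc A B))
    (hfA : f A = 0) (hfB : f B = l) (hgA : g A = 0) (hgB : g B = 0)
    (hbv : BoundedVariationOn g (Icc A B)) :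
    ∃ φ : ℝ → ℝ, (∀ s, s ∉ Icc (0 : ℝ) l → φ s = 0) ∧ BoundedVariationOn φ (Icc 0 l) ∧
      (fun r => (f r, g r)) '' Icc A B = genGraph φ l := by
  classical
  have hAI : A ∈ Icc A B := ⟨le_rfl, hAB⟩
  have hBI : B ∈ Icc A B := ⟨hAB, le_rfl⟩
  have hrange : ∀ r ∈ Icc A B, f r ∈ Icc 0 l := fun r hr =>
    ⟨hfA ▸ hm hAI hr hr.1, hfB ▸ hm hr hBI hr.2⟩
  have hlevel : ∀ s ∈ Icc 0 l, IsCompact (Icc A B ∩ f ⁻¹' {s}) ∧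
      (Icc A B ∩ f ⁻¹' {s}).Nonempty := fun s hs => by
    constructor
    · exact isCompact_Icc.of_isClosed_subset
        (hf.preimage_isClosed_of_isClosed isClosed_Icc isClosed_singleton) inter_subset_left
    · obtain ⟨r, hr, hrs⟩ := intermediate_value_Icc hAB hf (show s ∈ Icc (f A) (f B) by
        rwa [hfA, hfB])
      exact ⟨r, hr, hrs⟩
  have hfirst := fun s hs => (hlevel s hs).1.exists_isLeast (hlevel s hs).2
  have hlast := fun s hs => (hlevel s hs).1.exists_isGreatest (hlevel s hs).2
  choose! σ hσ using hfirst
  choose! τ hτ using hlast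
  have hστ : ∀ s ∈ Icc 0 l, σ s ≤ τ s := fun s hs => (hσ s hs).2 (hτ s hs).1
  have hlt : ∀ r ∈ Icc A B, ∀ r' ∈ Icc A B, f r < f r' → r < r' := fun r hr r' hr' h => by
    by_contra hcon
    exact absurd (hm hr' hr (not_lt.1 hcon)) (not_le.2 h)
  have hfτ : ∀ s ∈ Icc 0 l, f (τ s) = s := fun s hs => (hτ s hs).1.2
  have hfσ : ∀ s ∈ Icc 0 l, f (σ s) = s := fun s hs => (hσ s hs).1.2
  have hτI : ∀ s ∈ Icc 0 l, τ s ∈ Icc A B := fun s hs => (hτ s hs).1.1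
  have hσI : ∀ s ∈ Icc 0 l, σ s ∈ Icc A B := fun s hs => (hσ s hs).1.1
  have hτm : MonotoneOn τ (Icc 0 l) := by
    intro s hs s' hs' hss
    rcases hss.eq_or_lt with rfl | h
    · rfl
    · exact (hlt _ (hτI s hs) _ (hτI s' hs') (by rwa [hfτ s hs, hfτ s' hs'])).le
  have hσ0 : σ 0 = A := le_antisymm ((hσ 0 ⟨le_rfl, hl.le⟩).2 ⟨hAI, hfA⟩)
    (hσI 0 ⟨le_rfl, hl.le⟩).1
  have hτl : τ l = B := le_antisymm (hτI l ⟨hl.le, le_rfl⟩).2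
    ((hτ l ⟨hl.le, le_rfl⟩).2 ⟨hBI, hfB⟩)
  have hconst : ∀ s ∈ Icc 0 l, ∀ r ∈ Icc (σ s) (τ s), r ∈ Icc A B ∧ f r = s := fun s hs r hr => by
    have hrI : r ∈ Icc A B := ⟨(hσI s hs).1.trans hr.1, hr.2.trans (hτI s hs).2⟩
    refine ⟨hrI, le_antisymm ?_ ?_⟩
    · have := hm hrI (hτI s hs) hr.2
      rwa [hfτ s hs] at this
    · have := hm (hσI s hs) hrI hr.1
      rwa [hfσ s hs] at this
  have huIcc : ∀ s ∈ Icc 0 l, g '' Icc (σ s) (τ s) = segment ℝ (g (σ s)) (g (τ s)) := by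
    intro s hs
    have hsub : Icc (σ s) (τ s) ⊆ Icc A B := fun r hr => (hconst s hs r hr).1
    have hgc := hg.mono hsub
    have hgi : InjOn g (Icc (σ s) (τ s)) := fun r hr r' hr' h =>
      hinj (hsub hr) (hsub hr') (by
        simp only [h, (hconst s hs r hr).2, (hconst s hs r' hr').2])
    have hl' : σ s ∈ Icc (σ s) (τ s) := ⟨le_rfl, hστ s hs⟩
    have hr' : τ s ∈ Icc (σ s) (τ s) := ⟨hστ s hs, le_rfl⟩
    rw [segment_eq_uIcc]
    refine Subset.antisymm ?_ ?_
    · rintro _ ⟨r, hr, rfl⟩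
      rcases hgc.strictMonoOn_of_injOn_Icc' (hστ s hs) hgi with h | h
      · exact Icc_subset_uIcc ⟨h.monotoneOn hl' hr hr.1, h.monotoneOn hr hr' hr.2⟩
      · exact Icc_subset_uIcc' ⟨h.antitoneOn hr hr' hr.2, h.antitoneOn hl' hr hr.1⟩
    · have := intermediate_value_uIcc (f := g) (a := σ s) (b := τ s)
        (by rwa [uIcc_of_le (hστ s hs)])
      rwa [uIcc_of_le (hστ s hs)] at this
  set φ : ℝ → ℝ := fun s => if s ∈ Icc 0 l then g (τ s) else 0 with hφ
  have hφin : ∀ s ∈ Icc 0 l, φ s = g (τ s) := fun s hs => if_pos hs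
  have hφout : ∀ s, s ∉ Icc 0 l → φ s = 0 := fun s hs => if_neg hs
  have hleft : ∀ s ∈ Icc 0 l, Tendsto φ (𝓝[<] s) (𝓝 (g (σ s))) := by
    intro s hs
    rcases hs.1.eq_or_lt with rfl | h0
    · rw [hσ0, hgA]
      refine tendsto_const_nhds.congr' ?_
      filter_upwards [self_mem_nhdsWithin] with x hx
      exact (hφout x fun h => absurd h.1 (not_le.2 hx)).symm
    · have hin : ∀ᶠ x in 𝓝[<] s, x ∈ Ico 0 s := Ico_mem_nhdsLT h0
      have hin' : ∀ x ∈ Ico 0 s, x ∈ Icc 0 l := fun x hx => ⟨hx.1, hx.2.le.trans hs.2⟩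
      have hup : ∀ x ∈ Ico 0 s, τ x < σ s := fun x hx =>
        hlt _ (hτI x (hin' x hx)) _ (hσI s hs) (by
          rw [hfτ x (hin' x hx), hfσ s hs]; exact hx.2)
      have hτt : Tendsto τ (𝓝[<] s) (𝓝[Icc A B] (σ s)) := by
        refine tendsto_nhdsWithin_iff.2 ⟨?_, hin.mono fun x hx => hτI x (hin' x hx)⟩
        refine tendsto_order.2 ⟨fun r hr => ?_, fun r hr => ?_⟩
        · rcases lt_or_ge r A with hrA | hrA
          · exact hin.mono fun x hx => hrA.trans_le (hτI x (hin' x hx)).1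
          · have hrI : r ∈ Icc A B := ⟨hrA, hr.le.trans (hσI s hs).2⟩
            have hfr : f r < s := by
              have h1 := hm hrI (hσI s hs) hr.le
              rw [hfσ s hs] at h1
              refine h1.lt_of_ne fun h => ?_
              exact absurd ((hσ s hs).2 ⟨hrI, h⟩) (not_le.2 hr)
            filter_upwards [hin, Ioo_mem_nhdsLT hfr] with x hx hx'
            exact hlt _ hrI _ (hτI x (hin' x hx)) (by rw [hfτ x (hin' x hx)]; exact hx'.1)
        · exact hin.mono fun x hx => (hup x hx).trans hr
      refine ((hg (σ s) (hσI s hs)).tendsto.comp hτt).congr' ?_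
      exact hin.mono fun x hx => (hφin x (hin' x hx)).symm
  have hright : ∀ s ∈ Icc 0 l, Tendsto φ (𝓝[>] s) (𝓝 (g (τ s))) := by
    intro s hs
    rcases hs.2.eq_or_lt with rfl | h0
    · rw [hτl, hgB]
      refine tendsto_const_nhds.congr' ?_
      filter_upwards [self_mem_nhdsWithin] with x hx
      exact (hφout x fun h => absurd h.2 (not_le.2 hx)).symm
    · have hin : ∀ᶠ x in 𝓝[>] s, x ∈ Ioc s l := Ioc_mem_nhdsGT h0
      have hin' : ∀ x ∈ Ioc s l, x ∈ Icc 0 l := fun x hx => ⟨hs.1.trans hx.1.le, hx.2⟩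
      have hτt : Tendsto τ (𝓝[>] s) (𝓝[Icc A B] (τ s)) := by
        refine tendsto_nhdsWithin_iff.2 ⟨?_, hin.mono fun x hx => hτI x (hin' x hx)⟩
        refine tendsto_order.2 ⟨fun r hr => ?_, fun r hr => ?_⟩
        · exact hin.mono fun x hx => hr.trans_le (hτm hs (hin' x hx) hx.1.le)
        · rcases lt_or_ge B r with hrB | hrB
          · exact hin.mono fun x hx => (hτI x (hin' x hx)).2.trans_lt hrB
          · have hrI : r ∈ Icc A B := ⟨(hτI s hs).1.trans hr.le, hrB⟩
            have hfr : s < f r := by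
              have h1 := hm (hτI s hs) hrI hr.le
              rw [hfτ s hs] at h1
              refine h1.lt_of_ne fun h => ?_
              exact absurd ((hτ s hs).2 ⟨hrI, h.symm⟩) (not_le.2 hr)
            filter_upwards [hin, Ioo_mem_nhdsGT hfr] with x hx hx'
            exact hlt _ (hτI x (hin' x hx)) _ hrI (by rw [hfτ x (hin' x hx)]; exact hx'.2)
      refine ((hg (τ s) (hτI s hs)).tendsto.comp hτt).congr' ?_
      exact hin.mono fun x hx => (hφin x (hin' x hx)).symm
  refine ⟨φ, hφout, ?_, ?_⟩
  · have : eVariationOn φ (Icc 0 l) = eVariationOn (g ∘ τ) (Icc 0 l) :=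
      eVariationOn.congr hφin
    rw [BoundedVariationOn, this]
    exact ne_top_of_le_ne_top hbv (eVariationOn.comp_le_of_monotoneOn g τ hτm hτI)
  · ext q
    constructor
    · rintro ⟨r, hr, rfl⟩
      have hs := hrange r hr
      have hrI : r ∈ Icc (σ (f r)) (τ (f r)) := ⟨(hσ _ hs).2 ⟨hr, rfl⟩, (hτ _ hs).2 ⟨hr, rfl⟩⟩
      have hmem : g r ∈ segment ℝ (g (σ (f r))) (g (τ (f r))) :=
        huIcc (f r) hs ▸ mem_image_of_mem g hrI
      obtain ⟨a, b, ha, hb, hab, h⟩ := hmem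
      refine ⟨f r, hs, a, ⟨ha, by linarith⟩, _, _, hleft _ hs, hright _ hs, ?_⟩
      rw [Prod.mk.injEq, ← h, ← hab]
      simp
    · rintro ⟨s, hs, θ, hθ, lm, rm, hlm, hrm, rfl⟩
      obtain rfl := tendsto_nhds_unique hlm (hleft s hs)
      obtain rfl := tendsto_nhds_unique hrm (hright s hs)
      have hmem : θ * g (σ s) + (1 - θ) * g (τ s) ∈ segment ℝ (g (σ s)) (g (τ s)) :=
        ⟨θ, 1 - θ, hθ.1, by linarith [hθ.2], by ring, rfl⟩
      rw [← huIcc s hs] at hmem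
      obtain ⟨r, hr, hgr⟩ := hmem
      exact ⟨r, (hconst s hs r hr).1, by simp only [hgr, (hconst s hs r hr).2]⟩

theorem abs_planeDot_le (v x : ℂ) : |planeDot v x| ≤ ‖v‖ * ‖x‖ := by
  have : planeDot v x = inner ℝ v x := by
    rw [Complex.inner]; simp [planeDot]; ring
  rw [this]
  exact abs_real_inner_le_norm v x

theorem lipschitzWith_planeDot (v : ℂ) : LipschitzWith ‖v‖₊ (planeDot v) :=
  LipschitzWith.of_dist_le_mul fun x y => by
    rw [Real.dist_eq, ← planeDot_sub, dist_eq_norm]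
    exact abs_planeDot_le v _

theorem IsChainArc.exists_path {d e : ℂ} {K : Set ℂ} {a p : ℂ} (h : IsChainArc d e K a p)
    (hde : planeCross d e ≠ 0) : ∃ (A B : ℝ) (γ : ℝ → ℂ) (C : NNReal), A ≤ B ∧
      LipschitzOnWith C γ (Icc A B) ∧ γ '' Icc A B = K ∧ γ A = a ∧ γ B = p ∧
      InjOn γ (Icc A B) ∧ MonotoneOn (fun r => planeDot d (γ r)) (Icc A B) ∧
      MonotoneOn (fun r => planeDot e (γ r)) (Icc A B) := by
  obtain ⟨γ, C, hγ, him, hw⟩ := h.exists_lipschitz_param hde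
  set A := planeDot d a + planeDot e a with hA
  set B := planeDot d p + planeDot e p with hB
  have hAB : A ≤ B := by
    have := h.left_le p h.right_mem
    linarith [this.1, this.2]
  have hmem : ∀ r ∈ Icc A B, γ r ∈ K := fun r hr => him ▸ mem_image_of_mem γ hr
  have hle : ∀ r ∈ Icc A B, ∀ s ∈ Icc A B, r ≤ s → planeDot d (γ r) ≤ planeDot d (γ s) ∧
      planeDot e (γ r) ≤ planeDot e (γ s) := fun r hr s hs hrs =>
    h.le_of_weight_le (hmem r hr) (hmem s hs) (by rwa [hw r hr, hw s hs])
  refine ⟨A, B, γ, C, hAB, hγ, him, ?_, ?_, ?_, fun r hr s hs hrs => (hle r hr s hs hrs).1,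
    fun r hr s hs hrs => (hle r hr s hs hrs).2⟩
  · exact h.eq_of_weight_eq hde (hmem A ⟨le_rfl, hAB⟩) h.left_mem (hw A ⟨le_rfl, hAB⟩)
  · exact h.eq_of_weight_eq hde (hmem B ⟨hAB, le_rfl⟩) h.right_mem (hw B ⟨hAB, le_rfl⟩)
  · intro r hr s hs hrs
    rw [← hw r hr, ← hw s hs, hrs]

/-- Two chain arcs from the endpoints of a side, meeting exactly at their common endpoint, form the
generalized graph of a function of bounded variation over this side. -/
theorem exists_genGraph_of_isChainArc {a b p e e' : ℂ} {G₁ G₂ : Set ℂ} (hab : a ≠ b)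
    (h₁ : IsChainArc (b - a) e G₁ a p) (h₂ : IsChainArc e' (-(b - a)) G₂ b p)
    (hc₁ : planeCross (b - a) e ≠ 0) (hc₂ : planeCross e' (-(b - a)) ≠ 0)
    (hint : G₁ ∩ G₂ = {p}) :
    ∃ φ : ℝ → ℝ, (∀ s, s ∉ Icc (0 : ℝ) ‖b - a‖ → φ s = 0) ∧
      BoundedVariationOn φ (Icc 0 ‖b - a‖) ∧
      G₁ ∪ G₂ = sideEmbed a b '' genGraph φ ‖b - a‖ := by
  have hl : 0 < ‖b - a‖ := norm_pos_iff.2 (sub_ne_zero.2 hab.symm)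
  obtain ⟨A, P, γ, C, hAP, hγL, rfl, hγA, hγP, hγi, hγm, -⟩ := h₁.exists_path hc₁
  obtain ⟨R, Q, η, C', hRQ, hηL, rfl, hηR, hηQ, hηi, -, hηm⟩ := h₂.exists_path hc₂
  set B := P + Q - R with hB
  have hPB : P ≤ B := by linarith
  have hAB : A ≤ B := hAP.trans hPB
  set c : ℝ → ℂ := fun r => γ (min r P) + η (P + Q - max r P) - p with hcdef
  have hcl : ∀ r ∈ Icc A P, c r = γ r := fun r hr => by
    simp only [hcdef, min_eq_left hr.2, max_eq_right hr.2, add_sub_cancel_left, hηQ]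
    ring
  have hcr : ∀ r ∈ Icc P B, c r = η (P + Q - r) := fun r hr => by
    simp only [hcdef, min_eq_right hr.1, max_eq_left hr.1, hγP]
    ring
  have hmapr : ∀ r ∈ Icc P B, P + Q - r ∈ Icc R Q := fun r hr =>
    ⟨by linarith [hr.2], by linarith [hr.1]⟩
  have hcL : LipschitzOnWith (C * 1 + C' * (0 + 1) + 0) c (Icc A B) := by
    have h1 : LipschitzOnWith (C * 1) (fun r => γ (min r P)) (Icc A B) :=
      hγL.comp (LipschitzWith.id.min_const P).lipschitzOnWith
        fun r hr => ⟨le_min hr.1 hAP, min_le_right _ _⟩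
    have h2 : LipschitzOnWith (C' * (0 + 1)) (fun r => η (P + Q - max r P)) (Icc A B) :=
      hηL.comp ((LipschitzWith.const (P + Q)).sub
        (LipschitzWith.id.max_const P)).lipschitzOnWith fun r hr => by
          have h3 : max r P ≤ B := max_le hr.2 hPB
          have h4 : P ≤ max r P := le_max_right _ _
          constructor
          · change R ≤ P + Q - max r P
            linarith
          · change P + Q - max r P ≤ Q
            linarith
    exact (h1.add h2).sub (LipschitzWith.const p).lipschitzOnWith
  have him : c '' Icc A B = γ '' Icc A P ∪ η '' Icc R Q := by
    rw [← Icc_union_Icc_eq_Icc hAP hPB, image_union, image_congr hcl, image_congr hcr]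
    congr 1
    ext x
    constructor
    · rintro ⟨r, hr, rfl⟩
      exact ⟨_, hmapr r hr, rfl⟩
    · rintro ⟨r, hr, rfl⟩
      exact ⟨P + Q - r, ⟨by linarith [hr.2], by linarith [hr.1]⟩, by simp⟩
  have hmono : MonotoneOn (fun r => planeDot (b - a) (c r)) (Icc A B) := by
    rw [← Icc_union_Icc_eq_Icc hAP hPB]
    refine MonotoneOn.union_right (c := P) ?_ ?_ ⟨⟨hAP, le_rfl⟩, fun r hr => hr.2⟩
      ⟨⟨le_rfl, hPB⟩, fun r hr => hr.1⟩
    · intro r hr s hs hrs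
      simp only [hcl r hr, hcl s hs]
      exact hγm hr hs hrs
    · intro r hr s hs hrs
      have := hηm (hmapr s hs) (hmapr r hr) (by linarith)
      simp only [planeDot_neg] at this
      simp only [hcr r hr, hcr s hs]
      linarith
  have hinj : InjOn c (Icc A B) := by
    have hmix : ∀ r ∈ Icc A P, ∀ s ∈ Icc P B, c r = c s → r = s := fun r hr s hs h => by
      rw [hcl r hr, hcr s hs] at h
      have hp : γ r ∈ γ '' Icc A P ∩ η '' Icc R Q :=
        ⟨mem_image_of_mem γ hr, h ▸ mem_image_of_mem η (hmapr s hs)⟩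
      rw [hint, mem_singleton_iff] at hp
      have h1 := hγi hr ⟨hAP, le_rfl⟩ (hp.trans hγP.symm)
      have h2 := hηi (hmapr s hs) ⟨hRQ, le_rfl⟩ (by rw [← h, hp, hηQ])
      linarith
    intro r hr s hs h
    rcases le_total r P with h1 | h1 <;> rcases le_total s P with h2 | h2
    · rw [hcl r ⟨hr.1, h1⟩, hcl s ⟨hs.1, h2⟩] at h
      exact hγi ⟨hr.1, h1⟩ ⟨hs.1, h2⟩ h
    · exact hmix r ⟨hr.1, h1⟩ s ⟨h2, hs.2⟩ h
    · exact (hmix s ⟨hs.1, h2⟩ r ⟨h1, hr.2⟩ h.symm).symm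
    · rw [hcr r ⟨h1, hr.2⟩, hcr s ⟨h2, hs.2⟩] at h
      have := hηi (hmapr r ⟨h1, hr.2⟩) (hmapr s ⟨h2, hs.2⟩) h
      linarith
  have hcA : c A = a := by rw [hcl A ⟨le_rfl, hAP⟩, hγA]
  have hcB : c B = b := by
    rw [hcr B ⟨hPB, le_rfl⟩, hB, ← hηR]
    congr 1; ring
  have hlipCoord : ∀ v : ℂ, LipschitzWith (‖(‖b - a‖⁻¹ : ℝ)‖₊ * (‖v‖₊ * (1 + 0)))
      (fun x => planeDot v (x - a) / ‖b - a‖) := fun v => by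
    have h1 := (lipschitzWith_planeDot v).comp (LipschitzWith.id.sub (LipschitzWith.const a))
    refine LipschitzWith.of_dist_le_mul fun x y => ?_
    have h2 := h1.dist_le_mul x y
    rw [Real.dist_eq] at h2 ⊢
    rw [← sub_div, div_eq_inv_mul, abs_mul, NNReal.coe_mul, mul_assoc]
    exact mul_le_mul_of_nonneg_left h2 (abs_nonneg _)
  have hg := (hlipCoord (Complex.I * (b - a))).comp_lipschitzOnWith hcL
  have hf := (hlipCoord (b - a)).comp_lipschitzOnWith hcL
  have hca := sideCoord_sideEmbed hab (0, 0)
  have hcb := sideCoord_sideEmbed hab (‖b - a‖, 0)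
  rw [sideEmbed_zero] at hca
  rw [sideEmbed_length hab] at hcb
  obtain ⟨φ, hext, hbv, hφ⟩ := exists_genGraph_eq_image (f := fun r => (sideCoord a b (c r)).1)
    (g := fun r => (sideCoord a b (c r)).2) hl hAB hf.continuousOn hg.continuousOn
    (fun r hr s hs h => hinj hr hs (by
      rw [← sideEmbed_sideCoord hab (c r), ← sideEmbed_sideCoord hab (c s)]
      exact congrArg _ h))
    (fun r hr s hs hrs => by
      have := hmono hr hs hrs
      simp only [sideCoord, planeDot_sub] at this ⊢
      gcongr)
    (by rw [hcA, hca]) (by rw [hcB, hcb]) (by rw [hcA, hca]) (by rw [hcB, hcb]) (by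
      have := hg.locallyBoundedVariationOn A B ⟨le_rfl, hAB⟩ ⟨hAB, le_rfl⟩
      rwa [inter_self] at this)
  refine ⟨φ, hext, hbv, ?_⟩
  rw [← hφ, ← him, image_image]
  exact image_congr fun r hr => (sideEmbed_sideCoord hab (c r)).symm

theorem mem_genGraph_iff_of_continuousAt {φ : ℝ → ℝ} {l s t : ℝ} (h : ContinuousAt φ s) :
    (s, t) ∈ genGraph φ l ↔ s ∈ Icc 0 l ∧ t = φ s := by
  have hl : Tendsto φ (𝓝[<] s) (𝓝 (φ s)) := h.tendsto.mono_left nhdsWithin_le_nhds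
  have hr : Tendsto φ (𝓝[>] s) (𝓝 (φ s)) := h.tendsto.mono_left nhdsWithin_le_nhds
  constructor
  · rintro ⟨s', hs', θ, -, lm, rm, hlm, hrm, heq⟩
    obtain ⟨rfl, rfl⟩ := Prod.mk.inj heq
    rw [tendsto_nhds_unique hlm hl, tendsto_nhds_unique hrm hr]
    exact ⟨hs', by ring⟩
  · rintro ⟨hs, rfl⟩
    exact ⟨s, hs, 0, ⟨le_rfl, zero_le_one⟩, φ s, φ s, hl, hr, by simp⟩

theorem continuous_sideCoord (a b : ℂ) : Continuous (sideCoord a b) := by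
  unfold sideCoord
  exact (((continuous_planeDot _).comp (continuous_id.sub continuous_const)).div_const _).prodMk
    (((continuous_planeDot _).comp (continuous_id.sub continuous_const)).div_const _)

theorem BoundedVariationOn.aemeasurable_restrict_Icc {φ : ℝ → ℝ} {l : ℝ}
    (h : BoundedVariationOn φ (Icc 0 l)) : AEMeasurable φ (volume.restrict (Icc 0 l)) := by
  obtain ⟨p, q, hp, hq, rfl⟩ := h.locallyBoundedVariationOn.exists_monotoneOn_sub_monotoneOn
  exact (aemeasurable_restrict_of_monotoneOn measurableSet_Icc hp).sub
    (aemeasurable_restrict_of_monotoneOn measurableSet_Icc hq)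

theorem BoundedVariationOn.ae_continuousAt_Icc {φ : ℝ → ℝ} {l : ℝ} (hl : 0 ≤ l)
    (h : BoundedVariationOn φ (Icc 0 l)) :
    ∀ᵐ s ∂volume.restrict (Icc 0 l), ContinuousAt φ s := by
  rw [ae_restrict_iff' measurableSet_Icc]
  rw [← uIcc_of_le hl] at h
  filter_upwards [h.ae_differentiableAt_of_mem_uIcc] with s hs hs'
  exact (hs (by rwa [uIcc_of_le hl])).continuousAt

theorem tendsto_of_kuratowskiLim {T : Set ℂ} {a b : ℂ} (hab : a ≠ b) (hT : IsCompact T)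
    {φn : ℕ → ℝ → ℝ} {φ : ℝ → ℝ} {Kn : ℕ → Set ℂ} {K : Set ℂ} {c s : ℝ}
    (hs : s ∈ Icc 0 ‖b - a‖)
    (hφn : ∀ n, ContinuousAt (φn n) s) (hφ : ContinuousAt φ s)
    (hKn : ∀ n, Kn n = sideEmbed a b '' genGraph (φn n) ‖b - a‖) (hKT : ∀ n, Kn n ⊆ T)
    (hlim : KuratowskiLim Kn K)
    (hK : K ⊆ sideEmbed a b '' genGraph φ ‖b - a‖ ∪ {x | planeDot (b - a) x = c})
    (hsc : planeDot (b - a) a + s * ‖b - a‖ ≠ c) :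
    Tendsto (fun n => φn n s) atTop (𝓝 (φ s)) := by
  have hmem : ∀ n, sideEmbed a b (s, φn n s) ∈ Kn n := fun n => by
    rw [hKn]
    exact mem_image_of_mem _ ((mem_genGraph_iff_of_continuousAt (hφn n)).2 ⟨hs, rfl⟩)
  refine tendsto_of_subseq_tendsto fun ns hns => ?_
  obtain ⟨ms, hms, hnms⟩ := strictMono_subseq_of_tendsto_atTop hns
  obtain ⟨y, -, ks, hks, hy⟩ := hT.tendsto_subseq
    (x := fun k => sideEmbed a b (s, φn (ns (ms k)) s)) fun k => hKT _ (hmem _)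
  have hyK : y ∈ K := hlim.upper (fun k => ns (ms (ks k))) (hnms.comp hks) _
    (fun k => hmem _) y hy
  have hco := ((continuous_sideCoord a b).tendsto y).comp hy
  have hco' : Tendsto (fun k => (s, φn (ns (ms (ks k))) s)) atTop (𝓝 (sideCoord a b y)) :=
    hco.congr fun k => by simp [sideCoord_sideEmbed hab]
  have h1 : (sideCoord a b y).1 = s :=
    (tendsto_nhds_unique ((continuous_fst.tendsto _).comp hco') tendsto_const_nhds)
  have h2 : Tendsto (fun k => φn (ns (ms (ks k))) s) atTop (𝓝 (sideCoord a b y).2) :=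
    (continuous_snd.tendsto _).comp hco'
  refine ⟨fun k => ms (ks k), ?_⟩
  convert h2 using 2
  rcases hK hyK with ⟨⟨s', t⟩, hq, rfl⟩ | hc
  · rw [sideCoord_sideEmbed hab] at h1 ⊢
    obtain rfl : s' = s := h1
    exact ((mem_genGraph_iff_of_continuousAt hφ).1 hq).2.symm
  · refine absurd ?_ hsc
    rw [← h1, ← planeDot_sideEmbed hab, sideEmbed_sideCoord hab]
    exact hc

theorem tendsto_integral_abs_sub_of_kuratowskiLim {T : Set ℂ} {a b : ℂ} (hab : a ≠ b)
    (hT : IsCompact T) {φn : ℕ → ℝ → ℝ} {φ : ℝ → ℝ} {Kn : ℕ → Set ℂ} {K : Set ℂ} {c : ℝ}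
    (hφn : ∀ n, BoundedVariationOn (φn n) (Icc 0 ‖b - a‖))
    (hφ : BoundedVariationOn φ (Icc 0 ‖b - a‖))
    (hKn : ∀ n, Kn n = sideEmbed a b '' genGraph (φn n) ‖b - a‖) (hKT : ∀ n, Kn n ⊆ T)
    (hφT : sideEmbed a b '' genGraph φ ‖b - a‖ ⊆ T) (hlim : KuratowskiLim Kn K)
    (hK : K ⊆ sideEmbed a b '' genGraph φ ‖b - a‖ ∪ {x | planeDot (b - a) x = c}) :
    Tendsto (fun n => ∫ s in Icc 0 ‖b - a‖, |φn n s - φ s|) atTop (𝓝 0) := by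
  have hl : 0 < ‖b - a‖ := norm_pos_iff.2 (sub_ne_zero.2 hab.symm)
  obtain ⟨R, hR⟩ := ((hT.image (continuous_sideCoord a b)).isBounded).exists_norm_le
  have bound : ∀ ψ : ℝ → ℝ, sideEmbed a b '' genGraph ψ ‖b - a‖ ⊆ T → ∀ s ∈ Icc 0 ‖b - a‖,
      ContinuousAt ψ s → |ψ s| ≤ R := fun ψ hψ s hs hc => by
    have := hR _ (mem_image_of_mem _ (hψ (mem_image_of_mem (sideEmbed a b)
      ((mem_genGraph_iff_of_continuousAt hc).2 ⟨hs, rfl⟩))))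
    rw [sideCoord_sideEmbed hab] at this
    exact (norm_snd_le _).trans this
  have hcn : ∀ᵐ s ∂volume.restrict (Icc 0 ‖b - a‖), ∀ n, ContinuousAt (φn n) s :=
    ae_all_iff.2 fun n => (hφn n).ae_continuousAt_Icc hl.le
  have hc := hφ.ae_continuousAt_Icc hl.le
  have hin : ∀ᵐ s ∂volume.restrict (Icc 0 ‖b - a‖), s ∈ Icc 0 ‖b - a‖ :=
    ae_restrict_mem measurableSet_Icc
  have hne : ∀ᵐ s ∂volume.restrict (Icc 0 ‖b - a‖), planeDot (b - a) a + s * ‖b - a‖ ≠ c := by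
    refine ae_restrict_of_ae ?_
    filter_upwards [compl_mem_ae_iff.2
      (measure_singleton ((c - planeDot (b - a) a) / ‖b - a‖))] with s hs h
    exact hs (by rw [mem_singleton_iff, eq_div_iff hl.ne']; linarith)
  suffices Tendsto (fun n => ∫ s in Icc 0 ‖b - a‖, |φn n s - φ s|) atTop
      (𝓝 (∫ _ in Icc 0 ‖b - a‖, (0 : ℝ))) by simpa using this
  refine tendsto_integral_of_dominated_convergence (fun _ => R + R) (fun n => ?_)
    (integrable_const _) (fun n => ?_) ?_
  · exact (continuous_abs.measurable.comp_aemeasurable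
      ((hφn n).aemeasurable_restrict_Icc.sub hφ.aemeasurable_restrict_Icc)).aestronglyMeasurable
  · filter_upwards [hcn, hc, hin] with s hsn hs hs'
    rw [Real.norm_eq_abs, abs_abs]
    exact (abs_sub _ _).trans (add_le_add (bound _ (hKn n ▸ hKT n) s hs' (hsn n))
      (bound _ hφT s hs' hs))
  · filter_upwards [hcn, hc, hin, hne] with s hsn hs hs' hsc
    have := tendsto_of_kuratowskiLim hab hT hs' hsn hs hKn hKT hlim hK hsc
    simpa using (this.sub_const (φ s)).abs

theorem planeCross_ne_zero_of_not_collinear {a b c : ℂ}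
    (h : ¬ Collinear ℝ ({a, b, c} : Set ℂ)) : planeCross (b - a) (c - b) ≠ 0 := by
  refine fun h0 => h ?_
  rw [collinear_iff_of_mem (p₀ := a) (by simp)]
  by_cases hab : b = a
  · refine ⟨c - a, ?_⟩
    rintro x (rfl | rfl | rfl)
    · exact ⟨0, by simp⟩
    · exact ⟨0, by simp [hab]⟩
    · exact ⟨1, by simp⟩
  · refine ⟨b - a, ?_⟩
    rintro x (rfl | rfl | rfl)
    · exact ⟨0, by simp⟩
    · exact ⟨1, by simp⟩
    · have hn : planeDot (b - a) (b - a) ≠ 0 := by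
        rw [planeDot_self]
        exact pow_ne_zero _ (norm_ne_zero_iff.2 (sub_ne_zero.2 hab))
      refine ⟨1 + planeDot (b - a) (x - b) / planeDot (b - a) (b - a), ?_⟩
      obtain ⟨D, hD⟩ : ∃ D, D = planeDot (b - a) (b - a) := ⟨_, rfl⟩
      rw [← hD] at hn ⊢
      simp only [planeDot, planeCross, Complex.sub_re, Complex.sub_im] at hD h0 ⊢
      apply Complex.ext
      · simp only [vadd_eq_add, Complex.add_re, Complex.smul_re, smul_eq_mul, Complex.sub_re]
        field_simp
        linear_combination (-(b.im - a.im)) * h0 + (x.re - b.re) * hD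
      · simp only [vadd_eq_add, Complex.add_im, Complex.smul_im, smul_eq_mul, Complex.sub_im]
        field_simp
        linear_combination (b.re - a.re) * h0 + (x.im - b.im) * hD

theorem insert_rotate {α : Type*} (a b c : α) : ({a, b, c} : Set α) = {b, c, a} := by
  rw [insert_comm, pair_comm]

namespace BVConn

variable {α₁ α₂ α₃ : ℂ}

/-- Cyclic relabelling of the three vertices of a connection. -/
def rotate (Γ : BVConn α₁ α₂ α₃) : BVConn α₂ α₃ α₁ where
  Γ₁ := Γ.Γ₂
  Γ₂ := Γ.Γ₃
  Γ₃ := Γ.Γ₁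
  p := Γ.p
  φ₁₂ := Γ.φ₂₃
  φ₂₃ := Γ.φ₃₁
  φ₃₁ := Γ.φ₁₂
  p_mem := insert_rotate α₁ α₂ α₃ ▸ Γ.p_mem
  sub₁ := insert_rotate α₁ α₂ α₃ ▸ Γ.sub₂
  sub₂ := insert_rotate α₁ α₂ α₃ ▸ Γ.sub₃
  sub₃ := insert_rotate α₁ α₂ α₃ ▸ Γ.sub₁
  int₁₂ := Γ.int₂₃
  int₂₃ := Γ.int₃₁
  int₃₁ := Γ.int₁₂
  mem₁ := Γ.mem₂
  mem₂ := Γ.mem₃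
  mem₃ := Γ.mem₁
  ext₁₂ := Γ.ext₂₃
  ext₂₃ := Γ.ext₃₁
  ext₃₁ := Γ.ext₁₂
  bv₁₂ := Γ.bv₂₃
  bv₂₃ := Γ.bv₃₁
  bv₃₁ := Γ.bv₁₂
  graph₁₂ := Γ.graph₂₃
  graph₂₃ := Γ.graph₃₁
  graph₃₁ := Γ.graph₁₂

theorem isMonoArc (Γ : BVConn α₁ α₂ α₃) (h : α₁ ≠ α₂) :
    IsMonoArc (α₂ - α₁) (Γ.Γ₁ ∪ Γ.Γ₂) α₁ α₂ := by
  rw [Γ.graph₁₂]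
  exact isMonoArc_sideEmbed_genGraph h Γ.ext₁₂ Γ.bv₁₂

theorem isClosed_Γ₁ (Γ : BVConn α₁ α₂ α₃) (h₁₂ : α₁ ≠ α₂) (h₃₁ : α₃ ≠ α₁) :
    IsClosed Γ.Γ₁ := by
  have h : Γ.Γ₁ ∪ {Γ.p} = (Γ.Γ₁ ∪ Γ.Γ₂) ∩ (Γ.Γ₃ ∪ Γ.Γ₁) := by
    rw [← Γ.int₂₃]
    ext x
    simp only [mem_union, mem_inter_iff]
    tauto
  have hp : Γ.p ∈ Γ.Γ₁ := (Γ.int₁₂.symm ▸ mem_singleton Γ.p : Γ.p ∈ Γ.Γ₁ ∩ Γ.Γ₂).1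
  rw [union_eq_self_of_subset_right (singleton_subset_iff.2 hp)] at h
  rw [h]
  exact (Γ.isMonoArc h₁₂).isCompact.isClosed.inter
    (Γ.rotate.rotate.isMonoArc h₃₁).isCompact.isClosed

theorem isChainArc_Γ₁ (Γ : BVConn α₁ α₂ α₃) (h₁₂ : α₁ ≠ α₂) (h₂₃ : α₂ ≠ α₃) (h₃₁ : α₃ ≠ α₁) :
    IsChainArc (α₂ - α₁) (-(α₁ - α₃)) Γ.Γ₁ α₁ Γ.p := by
  have c₁ := Γ.isClosed_Γ₁ h₁₂ h₃₁
  have c₂ : IsClosed Γ.Γ₂ := Γ.rotate.isClosed_Γ₁ h₂₃ h₁₂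
  have c₃ : IsClosed Γ.Γ₃ := Γ.rotate.rotate.isClosed_Γ₁ h₃₁ h₂₃
  exact ((Γ.isMonoArc h₁₂).split c₁ c₂ Γ.int₁₂ Γ.mem₁ Γ.mem₂).1.isChainArc
    ((Γ.rotate.rotate.isMonoArc h₃₁).split c₃ c₁ Γ.int₃₁ Γ.mem₃ Γ.mem₁).2.reverse

end BVConn

/-- Sequential compactness of the nonempty compact subsets of a compact set of `ℂ`. -/
theorem exists_subseq_kuratowskiLim {T : Set ℂ} (hT : IsCompact T) {Kn : ℕ → Set ℂ}
    (hKn : ∀ n, IsCompact (Kn n)) (hne : ∀ n, (Kn n).Nonempty) (hKT : ∀ n, Kn n ⊆ T) :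
    ∃ (K : Set ℂ) (ns : ℕ → ℕ), StrictMono ns ∧ IsCompact K ∧ K ⊆ T ∧
      KuratowskiLim (fun k => Kn (ns k)) K := by
  let L : ℕ → TopologicalSpace.NonemptyCompacts ℂ := fun n => ⟨⟨Kn n, hKn n⟩, hne n⟩
  obtain ⟨K, hK, ns, hns, h⟩ :=
    (TopologicalSpace.NonemptyCompacts.isCompact_subsets_of_isCompact hT).tendsto_subseq
      (x := L) hKT
  exact ⟨K, ns, hns, K.isCompact, hK, kuratowskiLim_of_tendsto h⟩

theorem KuratowskiLim.comp_strictMono {Kn : ℕ → Set ℂ} {K : Set ℂ} (h : KuratowskiLim Kn K)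
    {ns : ℕ → ℕ} (hns : StrictMono ns) : KuratowskiLim (fun k => Kn (ns k)) K where
  lower x hx := by
    obtain ⟨u, hu, hux⟩ := h.lower x hx
    exact ⟨u ∘ ns, fun k => hu (ns k), hux.comp hns.tendsto_atTop⟩
  upper ms hms u hu x hx := h.upper (ns ∘ ms) (hns.comp hms) u hu x hx

theorem BVConn.exists_limit {α₁ α₂ α₃ : ℂ} (hncol : ¬ Collinear ℝ ({α₁, α₂, α₃} : Set ℂ))
    {G₁ G₂ G₃ : Set ℂ} {q : ℂ} (g₁ : IsChainArc (α₂ - α₁) (-(α₁ - α₃)) G₁ α₁ q)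
    (g₂ : IsChainArc (α₃ - α₂) (-(α₂ - α₁)) G₂ α₂ q)
    (g₃ : IsChainArc (α₁ - α₃) (-(α₃ - α₂)) G₃ α₃ q)
    (t₁ : G₁ ⊆ convexHull ℝ {α₁, α₂, α₃}) (t₂ : G₂ ⊆ convexHull ℝ {α₁, α₂, α₃})
    (t₃ : G₃ ⊆ convexHull ℝ {α₁, α₂, α₃}) (i₁₂ : G₁ ∩ G₂ = {q}) (i₂₃ : G₂ ∩ G₃ = {q})
    (i₃₁ : G₃ ∩ G₁ = {q}) :
    ∃ Γ : BVConn α₁ α₂ α₃, Γ.Γ₁ = G₁ ∧ Γ.Γ₂ = G₂ ∧ Γ.Γ₃ = G₃ := by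
  have hD := planeCross_ne_zero_of_not_collinear hncol
  have hs : (α₂ - α₁) + (α₃ - α₂) + (α₁ - α₃) = 0 := by ring
  have hs' : (α₃ - α₂) + (α₁ - α₃) + (α₂ - α₁) = 0 := by ring
  have hD2 : planeCross (α₃ - α₂) (α₁ - α₃) ≠ 0 := by rwa [planeCross_rotate hs]
  have hD3 : planeCross (α₁ - α₃) (α₂ - α₁) ≠ 0 := by rwa [planeCross_rotate hs']
  have neg : ∀ {d e : ℂ}, planeCross d e ≠ 0 → planeCross d (-e) ≠ 0 := fun h => by
    rwa [planeCross_neg_right, neg_ne_zero]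
  have swap : ∀ {d e : ℂ}, planeCross d e ≠ 0 → planeCross e d ≠ 0 := fun h => by
    rwa [planeCross_comm, neg_ne_zero]
  have h₁₂ : α₁ ≠ α₂ := by rintro rfl; simp [planeCross] at hD
  have h₂₃ : α₂ ≠ α₃ := by rintro rfl; simp [planeCross] at hD
  have h₃₁ : α₃ ≠ α₁ := by rintro rfl; simp [planeCross] at hD2
  obtain ⟨φ₁₂, e₁₂, b₁₂, u₁₂⟩ := exists_genGraph_of_isChainArc h₁₂ g₁ g₂
    (neg (swap hD3)) (neg (swap hD)) i₁₂
  obtain ⟨φ₂₃, e₂₃, b₂₃, u₂₃⟩ := exists_genGraph_of_isChainArc h₂₃ g₂ g₃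
    (neg (swap hD)) (neg (swap hD2)) i₂₃
  obtain ⟨φ₃₁, e₃₁, b₃₁, u₃₁⟩ := exists_genGraph_of_isChainArc h₃₁ g₃ g₁
    (neg (swap hD2)) (neg (swap hD3)) i₃₁
  exact ⟨⟨G₁, G₂, G₃, q, φ₁₂, φ₂₃, φ₃₁, t₁ g₁.right_mem, t₁, t₂, t₃, i₁₂, i₂₃, i₃₁, g₁.left_mem,
    g₂.left_mem, g₃.left_mem, e₁₂, e₂₃, e₃₁, b₁₂, b₂₃, b₃₁, u₁₂, u₂₃, u₃₁⟩, rfl, rfl, rfl⟩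

/-- Compactness of the class of BV graph-type connections: any sequence `Γⁿ` of BV
graph-type connections in the triangle `T` with vertices `α₁, α₂, α₃` admits a subsequence
converging, in the sense of `L¹` convergence of the three associated BV functions, to a
limit which is itself a BV graph-type connection in `T`. -/
theorem stmt_18 (α₁ α₂ α₃ : ℂ) (hncol : ¬ Collinear ℝ ({α₁, α₂, α₃} : Set ℂ))
    (Γn : ℕ → BVConn α₁ α₂ α₃) :
    ∃ ns : ℕ → ℕ, StrictMono ns ∧
      ∃ Γ : BVConn α₁ α₂ α₃,
        Tendsto (fun k => ∫ s in Icc (0:ℝ) ‖α₂ - α₁‖, |(Γn (ns k)).φ₁₂ s - Γ.φ₁₂ s|)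
          atTop (nhds 0) ∧
        Tendsto (fun k => ∫ s in Icc (0:ℝ) ‖α₃ - α₂‖, |(Γn (ns k)).φ₂₃ s - Γ.φ₂₃ s|)
          atTop (nhds 0) ∧
        Tendsto (fun k => ∫ s in Icc (0:ℝ) ‖α₁ - α₃‖, |(Γn (ns k)).φ₃₁ s - Γ.φ₃₁ s|)
          atTop (nhds 0) := by
  have hD := planeCross_ne_zero_of_not_collinear hncol
  have hs : (α₂ - α₁) + (α₃ - α₂) + (α₁ - α₃) = 0 := by ring
  have h₁₂ : α₁ ≠ α₂ := by rintro rfl; simp [planeCross] at hD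
  have h₂₃ : α₂ ≠ α₃ := by rintro rfl; simp [planeCross] at hD
  have h₃₁ : α₃ ≠ α₁ := by
    rintro rfl
    exact hD (by simp only [planeCross, Complex.sub_re, Complex.sub_im]; ring)
  have hT : IsCompact (convexHull ℝ ({α₁, α₂, α₃} : Set ℂ)) :=
    (Set.toFinite _).isCompact_convexHull ℝ
  have c₁ := fun n => (Γn n).isChainArc_Γ₁ h₁₂ h₂₃ h₃₁
  have c₂ := fun n => (Γn n).rotate.isChainArc_Γ₁ h₂₃ h₃₁ h₁₂
  have c₃ := fun n => (Γn n).rotate.rotate.isChainArc_Γ₁ h₃₁ h₁₂ h₂₃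
  obtain ⟨K₁, n₁, hn₁, k₁, s₁, l₁⟩ := exists_subseq_kuratowskiLim hT
    (fun n => (c₁ n).isCompact) (fun n => ⟨_, (c₁ n).left_mem⟩) fun n => (Γn n).sub₁
  obtain ⟨K₂, n₂, hn₂, k₂, s₂, l₂⟩ := exists_subseq_kuratowskiLim hT
    (fun n => (c₂ (n₁ n)).isCompact) (fun n => ⟨_, (c₂ (n₁ n)).left_mem⟩)
    fun n => (Γn (n₁ n)).sub₂
  obtain ⟨K₃, n₃, hn₃, k₃, s₃, l₃⟩ := exists_subseq_kuratowskiLim hT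
    (fun n => (c₃ (n₁ (n₂ n))).isCompact) (fun n => ⟨_, (c₃ (n₁ (n₂ n))).left_mem⟩)
    fun n => (Γn (n₁ (n₂ n))).sub₃
  obtain ⟨p, -, n₄, hn₄, hp⟩ := hT.tendsto_subseq fun n => (Γn (n₁ (n₂ (n₃ n)))).p_mem
  let ns : ℕ → ℕ := fun k => n₁ (n₂ (n₃ (n₄ k)))
  have m₁ : KuratowskiLim (fun k => (Γn (ns k)).Γ₁) K₁ :=
    l₁.comp_strictMono (hn₂.comp (hn₃.comp hn₄))
  have m₂ : KuratowskiLim (fun k => (Γn (ns k)).Γ₂) K₂ := l₂.comp_strictMono (hn₃.comp hn₄)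
  have m₃ : KuratowskiLim (fun k => (Γn (ns k)).Γ₃) K₃ := l₃.comp_strictMono hn₄
  obtain ⟨q, G₁, G₂, G₃, g₁, g₂, g₃, t₁, t₂, t₃, i₁₂, i₂₃, i₃₁, u₁₂, u₂₃, u₃₁⟩ :=
    hasTriplePoint (convex_convexHull ℝ _) hs hD
      (isChainArc_of_kuratowskiLim hT (fun k => (Γn (ns k)).sub₁) (fun k => c₁ (ns k)) k₁ m₁ hp)
      (isChainArc_of_kuratowskiLim hT (fun k => (Γn (ns k)).sub₂) (fun k => c₂ (ns k)) k₂ m₂ hp)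
      (isChainArc_of_kuratowskiLim hT (fun k => (Γn (ns k)).sub₃) (fun k => c₃ (ns k)) k₃ m₃ hp)
      s₁ s₂ s₃
  obtain ⟨Γ, rfl, rfl, rfl⟩ := BVConn.exists_limit hncol g₁ g₂ g₃ t₁ t₂ t₃ i₁₂ i₂₃ i₃₁
  refine ⟨ns, hn₁.comp (hn₂.comp (hn₃.comp hn₄)), Γ, ?_, ?_, ?_⟩
  · exact tendsto_integral_abs_sub_of_kuratowskiLim h₁₂ hT (fun k => (Γn (ns k)).bv₁₂) Γ.bv₁₂
      (fun k => (Γn (ns k)).graph₁₂) (fun k => union_subset (Γn (ns k)).sub₁ (Γn (ns k)).sub₂)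
      (Γ.graph₁₂ ▸ union_subset Γ.sub₁ Γ.sub₂) (m₁.union m₂) (Γ.graph₁₂ ▸ u₁₂)
  · exact tendsto_integral_abs_sub_of_kuratowskiLim h₂₃ hT (fun k => (Γn (ns k)).bv₂₃) Γ.bv₂₃
      (fun k => (Γn (ns k)).graph₂₃) (fun k => union_subset (Γn (ns k)).sub₂ (Γn (ns k)).sub₃)
      (Γ.graph₂₃ ▸ union_subset Γ.sub₂ Γ.sub₃) (m₂.union m₃) (Γ.graph₂₃ ▸ u₂₃)
  · exact tendsto_integral_abs_sub_of_kuratowskiLim h₃₁ hT (fun k => (Γn (ns k)).bv₃₁) Γ.bv₃₁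
      (fun k => (Γn (ns k)).graph₃₁) (fun k => union_subset (Γn (ns k)).sub₃ (Γn (ns k)).sub₁)
      (Γ.graph₃₁ ▸ union_subset Γ.sub₃ Γ.sub₁) (m₃.union m₁) (Γ.graph₃₁ ▸ u₃₁)
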